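/- arXiv:0908.3529 — 6 statements merged into one kernel-verified Lean document; each statement's English description precedes it below -/
import Mathlib

section
/- Let (Ω, ℱ, P) be a probability space and ℱ_1 ⊆ ℱ_2 ⊆ ⋯ a sequence of sub-σ-fields of ℱ. Let U_t, β_t, ξ_t, ζ_t (t = 1, 2, …) be non-negative ℱ_t-measurable random variables such that E(U_{t+1} | ℱ_t) ≤ (1 + β_t) U_t + ξ_t − ζ_t almost surely for every t. Then, almost surely on the event {Σ_t β_t < ∞ and Σ_t ξ_t < ∞}, the sequence U_t converges to a (finite) random variable and Σ_t ζ_t < ∞. -/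
open MeasureTheory Filter
open scoped Topology

/-- A submartingale whose next value is bounded above by a nondecreasing adapted process converges
almost surely on the event where that process is bounded. -/
theorem MeasureTheory.Submartingale.ae_exists_tendsto_of_le_of_bddAbove
    {Ω : Type*} {m0 : MeasurableSpace Ω} {μ : Measure Ω} [IsFiniteMeasure μ]
    {ℱ : Filtration ℕ m0} {f A : ℕ → Ω → ℝ} (hf : Submartingale f ℱ μ)
    (hA : StronglyAdapted ℱ A) (hA_mono : ∀ ω, Monotone fun t => A t ω)
    (hfA : ∀ t ω, f (t + 1) ω ≤ A t ω) :
    ∀ᵐ ω ∂μ, BddAbove (Set.range fun t => A t ω) →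
      ∃ l : ℝ, Tendsto (fun t => f t ω) atTop (𝓝 l) := by
  have key (a : ℕ) : ∀ᵐ ω ∂μ, (∀ t, A t ω ≤ a) →
      ∃ l : ℝ, Tendsto (fun t => f t ω) atTop (𝓝 l) := by
    let ind : ℕ → Ω → ℝ := fun k => {ω | A k ω ≤ a}.indicator 1
    let g : ℕ → Ω → ℝ := fun n => ∑ k ∈ Finset.range n, ind k * (f (k + 1) - f k)
    have hg : Submartingale g ℱ μ := by
      refine hf.sum_mul_sub (R := 1) (fun k => ?_) (fun k ω => ?_) (fun k ω => ?_)
      · exact stronglyMeasurable_one.indicator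
          ((hA k).measurableSet_le stronglyMeasurable_const)
      · exact Set.indicator_le_self' (fun _ _ => zero_le_one) ω
      · exact Set.indicator_nonneg (fun _ _ => zero_le_one) ω
    have hg_succ (n : ℕ) (ω : Ω) :
        g (n + 1) ω = g n ω + ind n ω * (f (n + 1) ω - f n ω) := by
      simp [g, Finset.sum_range_succ]
    have hg_eq (n : ℕ) (ω : Ω) (h : ∀ k < n, A k ω ≤ a) : g n ω = f n ω - f 0 ω := by
      induction n with
      | zero => simp [g]
      | succ n ih =>
        have hn : ind n ω = 1 :=
          Set.indicator_of_mem (s := {ω | A n ω ≤ a}) (h n n.lt_succ_self) _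
        rw [hg_succ, ih fun k hk => h k (hk.trans n.lt_succ_self), hn]
        ring
    have hg_le (n : ℕ) (ω : Ω) : g n ω ≤ a + |f 0 ω| := by
      induction n with
      | zero =>
        simp only [g, Finset.range_zero, Finset.sum_empty, Pi.zero_apply]
        positivity
      | succ n ih =>
        by_cases h : A n ω ≤ a
        · rw [hg_eq (n + 1) ω fun k hk => (hA_mono ω (Nat.lt_succ_iff.1 hk)).trans h]
          linarith [hfA n ω, neg_abs_le (f 0 ω)]
        · have hn : ind n ω = 0 := Set.indicator_of_notMem (s := {ω | A n ω ≤ a}) h _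
          rw [hg_succ, hn]
          linarith
    have hc_int : Integrable (fun ω => (a : ℝ) + |f 0 ω|) μ :=
      (integrable_const _).add (hf.integrable 0).abs
    have hg_bdd (n : ℕ) :
        eLpNorm (g n) 1 μ ≤ (2 * ∫ ω, ((a : ℝ) + |f 0 ω|) ∂μ).toNNReal := by
      rw [eLpNorm_one_eq_lintegral_enorm,
        ← ofReal_integral_norm_eq_lintegral_enorm (hg.integrable n)]
      refine ENNReal.ofReal_le_ofReal ?_
      have h0 : 0 ≤ ∫ ω, g n ω ∂μ := by
        simpa [g] using hg.setIntegral_le (Nat.zero_le n) MeasurableSet.univ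
      calc ∫ ω, ‖g n ω‖ ∂μ ≤ ∫ ω, (2 * ((a : ℝ) + |f 0 ω|) - g n ω) ∂μ := by
            refine integral_mono (hg.integrable n).norm
              ((hc_int.const_mul 2).sub (hg.integrable n)) fun ω => ?_
            have := hg_le n ω
            have : 0 ≤ (a : ℝ) + |f 0 ω| := by positivity
            exact abs_le.2 ⟨by linarith, by linarith⟩
        _ = 2 * ∫ ω, ((a : ℝ) + |f 0 ω|) ∂μ - ∫ ω, g n ω ∂μ := by
            rw [integral_sub (hc_int.const_mul 2) (hg.integrable n), integral_const_mul]
        _ ≤ _ := by linarith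
    filter_upwards [hg.exists_ae_tendsto_of_bdd hg_bdd] with ω ⟨l, hl⟩ hω
    refine ⟨l + f 0 ω, (hl.add_const (f 0 ω)).congr fun n => ?_⟩
    rw [hg_eq n ω fun k _ => hω k]
    ring
  filter_upwards [ae_all_iff.2 key] with ω hω ⟨b, hb⟩
  obtain ⟨a, ha⟩ := exists_nat_ge b
  exact hω a fun t => (hb ⟨t, rfl⟩).trans ha

/-- The Robbins–Siegmund theorem without multiplicative perturbation. -/
theorem ae_tendsto_and_summable_of_condExp_le_add_sub
    {Ω : Type*} {m0 : MeasurableSpace Ω} {μ : Measure Ω} [IsFiniteMeasure μ]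
    {ℱ : Filtration ℕ m0} {V ξ ζ : ℕ → Ω → ℝ}
    (hV_nonneg : ∀ t ω, 0 ≤ V t ω) (hξ_nonneg : ∀ t ω, 0 ≤ ξ t ω)
    (hζ_nonneg : ∀ t ω, 0 ≤ ζ t ω)
    (hV : StronglyAdapted ℱ V) (hξ : StronglyAdapted ℱ ξ) (hζ : StronglyAdapted ℱ ζ)
    (hV_int : ∀ t, Integrable (V t) μ) (hξ_int : ∀ t, Integrable (ξ t) μ)
    (hζ_int : ∀ t, Integrable (ζ t) μ)
    (hrec : ∀ t, ∀ᵐ ω ∂μ, (μ[V (t + 1) | ℱ t]) ω ≤ V t ω + ξ t ω - ζ t ω) :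
    ∀ᵐ ω ∂μ, Summable (fun t => ξ t ω) →
      (∃ l : ℝ, Tendsto (fun t => V t ω) atTop (𝓝 l)) ∧ Summable (fun t => ζ t ω) := by
  let S : ℕ → Ω → ℝ := fun t => ∑ s ∈ Finset.range t, (ξ s - ζ s)
  have hS_apply (t : ℕ) (ω : Ω) : S t ω =
      ∑ s ∈ Finset.range t, ξ s ω - ∑ s ∈ Finset.range t, ζ s ω := by
    simp [S]
  have hS_meas (t r : ℕ) (h : t ≤ r + 1) : StronglyMeasurable[ℱ r] (S t) :=
    Finset.stronglyMeasurable_sum _ fun s hs => by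
      have hsr : s ≤ r := by have := Finset.mem_range.1 hs; omega
      exact ((hξ s).sub (hζ s)).mono (ℱ.mono hsr)
  have hS_int (t : ℕ) : Integrable (S t) μ :=
    integrable_finsetSum' _ fun s _ => (hξ_int s).sub (hζ_int s)
  have hsub : Submartingale (fun t => S t - V t) ℱ μ := by
    refine submartingale_nat (fun t => (hS_meas t t t.le_succ).sub (hV t))
      (fun t => (hS_int t).sub (hV_int t)) fun t => ?_
    have hS_cond : μ[S (t + 1) | ℱ t] = S (t + 1) :=
      condExp_of_stronglyMeasurable (ℱ.le t) (hS_meas (t + 1) t le_rfl) (hS_int _)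
    filter_upwards [hrec t, condExp_sub (hS_int (t + 1)) (hV_int (t + 1)) (ℱ t)] with ω h1 h2
    rw [h2, Pi.sub_apply, Pi.sub_apply, hS_cond]
    simp only [S, Finset.sum_range_succ, Pi.add_apply, Pi.sub_apply]
    linarith
  have hconv := hsub.ae_exists_tendsto_of_le_of_bddAbove
    (A := fun t ω => ∑ s ∈ Finset.range (t + 1), ξ s ω)
    (fun t => by
      refine Finset.stronglyMeasurable_fun_sum _ fun s hs => ?_
      exact (hξ s).mono (ℱ.mono (Nat.lt_succ_iff.1 (Finset.mem_range.1 hs))))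
    (fun ω => monotone_nat_of_le_succ fun t => by
      rw [Finset.sum_range_succ _ (t + 1)]
      exact le_add_of_nonneg_right (hξ_nonneg (t + 1) ω))
    (fun t ω => by
      have := Finset.sum_nonneg fun s (_ : s ∈ Finset.range (t + 1)) => hζ_nonneg s ω
      simp only [Pi.sub_apply, hS_apply]
      linarith [hV_nonneg (t + 1) ω])
  filter_upwards [hconv] with ω hω hξω
  obtain ⟨l, hl⟩ := hω ⟨∑' s, ξ s ω, by
    rintro _ ⟨t, rfl⟩
    exact hξω.sum_le_tsum _ fun s _ => hξ_nonneg s ω⟩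
  have hVZ : Tendsto (fun t => V t ω + ∑ s ∈ Finset.range t, ζ s ω) atTop
      (𝓝 (∑' s, ξ s ω - l)) := by
    refine (hξω.hasSum.tendsto_sum_nat.sub hl).congr fun t => ?_
    simp only [Pi.sub_apply, hS_apply]
    ring
  obtain ⟨c, hc⟩ := hVZ.bddAbove_range
  have hζω : Summable (fun t => ζ t ω) :=
    summable_of_sum_range_le (c := c) (fun t => hζ_nonneg t ω) fun t => by
      have := hc ⟨t, rfl⟩
      simp only at this
      linarith [hV_nonneg t ω]
  refine ⟨⟨_, (hVZ.sub hζω.hasSum.tendsto_sum_nat).congr fun t => ?_⟩, hζω⟩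
  ring

/-- **Robbins–Siegmund theorem.** If the non-negative, `ℱ t`-measurable random
variables `U, β, ξ, ζ` satisfy `E[U (t+1) | ℱ t] ≤ (1 + β t) * U t + ξ t - ζ t` a.s.
for every `t`, then almost surely, on the event where `∑ β t < ∞` and `∑ ξ t < ∞`,
the sequence `U t` converges to a finite limit and `∑ ζ t < ∞`. -/
theorem robbins_siegmund
    {Ω : Type*} {m0 : MeasurableSpace Ω} {μ : Measure Ω} [IsProbabilityMeasure μ]
    (ℱ : Filtration ℕ m0)
    (U β ξ ζ : ℕ → Ω → ℝ)
    (hU_nonneg : ∀ t ω, 0 ≤ U t ω)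
    (hβ_nonneg : ∀ t ω, 0 ≤ β t ω)
    (hξ_nonneg : ∀ t ω, 0 ≤ ξ t ω)
    (hζ_nonneg : ∀ t ω, 0 ≤ ζ t ω)
    (hU_meas : ∀ t, StronglyMeasurable[ℱ t] (U t))
    (hβ_meas : ∀ t, StronglyMeasurable[ℱ t] (β t))
    (hξ_meas : ∀ t, StronglyMeasurable[ℱ t] (ξ t))
    (hζ_meas : ∀ t, StronglyMeasurable[ℱ t] (ζ t))
    (hU_int : ∀ t, Integrable (U t) μ)
    (hβ_int : ∀ t, Integrable (β t) μ)
    (hξ_int : ∀ t, Integrable (ξ t) μ)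
    (hζ_int : ∀ t, Integrable (ζ t) μ)
    (hrec : ∀ t, ∀ᵐ ω ∂μ,
      (μ[U (t + 1) | ℱ t]) ω ≤ (1 + β t ω) * U t ω + ξ t ω - ζ t ω) :
    ∀ᵐ ω ∂μ,
      (Summable (fun t => β t ω) ∧ Summable (fun t => ξ t ω)) →
        (∃ l : ℝ, Tendsto (fun t => U t ω) atTop (𝓝 l)) ∧
          Summable (fun t => ζ t ω) := by
  let q : ℕ → Ω → ℝ := fun t ω => ∏ s ∈ Finset.range t, (1 + β s ω)
  have hq_one (t : ℕ) (ω : Ω) : 1 ≤ q t ω :=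
    Finset.one_le_prod fun s _ => by linarith [hβ_nonneg s ω]
  have hq_pos (t : ℕ) (ω : Ω) : 0 < q t ω := zero_lt_one.trans_le (hq_one t ω)
  have hq_succ (t : ℕ) (ω : Ω) : q (t + 1) ω = q t ω * (1 + β t ω) :=
    Finset.prod_range_succ _ _
  have hq_meas (t r : ℕ) (h : t ≤ r + 1) : StronglyMeasurable[ℱ r] fun ω => (q t ω)⁻¹ := by
    refine StronglyMeasurable.inv₀ (Finset.stronglyMeasurable_fun_prod _ fun s hs => ?_)
    have hsr : s ≤ r := by have := Finset.mem_range.1 hs; omega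
    exact stronglyMeasurable_const.add ((hβ_meas s).mono (ℱ.mono hsr))
  have hq_bound (t : ℕ) : ∀ᵐ ω ∂μ, ‖(q t ω)⁻¹‖ ≤ 1 := ae_of_all _ fun ω => by
    rw [Real.norm_of_nonneg (inv_nonneg.2 (hq_pos t ω).le)]
    exact inv_le_one_of_one_le₀ (hq_one t ω)
  have hq_int (t : ℕ) {X : Ω → ℝ} (hX : Integrable X μ) :
      Integrable (fun ω => (q t ω)⁻¹ * X ω) μ :=
    hX.bdd_mul ((hq_meas t t t.le_succ).mono (ℱ.le t)).aestronglyMeasurable (hq_bound t)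
  have hdisc := ae_tendsto_and_summable_of_condExp_le_add_sub (μ := μ) (ℱ := ℱ)
    (V := fun t ω => (q t ω)⁻¹ * U t ω) (ξ := fun t ω => (q (t + 1) ω)⁻¹ * ξ t ω)
    (ζ := fun t ω => (q (t + 1) ω)⁻¹ * ζ t ω)
    (fun t ω => mul_nonneg (inv_nonneg.2 (hq_pos _ ω).le) (hU_nonneg t ω))
    (fun t ω => mul_nonneg (inv_nonneg.2 (hq_pos _ ω).le) (hξ_nonneg t ω))
    (fun t ω => mul_nonneg (inv_nonneg.2 (hq_pos _ ω).le) (hζ_nonneg t ω))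
    (fun t => (hq_meas t t t.le_succ).mul (hU_meas t))
    (fun t => (hq_meas (t + 1) t le_rfl).mul (hξ_meas t))
    (fun t => (hq_meas (t + 1) t le_rfl).mul (hζ_meas t))
    (fun t => hq_int t (hU_int t)) (fun t => hq_int (t + 1) (hξ_int t))
    (fun t => hq_int (t + 1) (hζ_int t))
    (fun t => by
      filter_upwards [hrec t, condExp_stronglyMeasurable_mul_of_bound (ℱ.le t)
        (hq_meas (t + 1) t le_rfl) (hU_int (t + 1)) 1 (hq_bound (t + 1))] with ω h1 h2
      refine h2.le.trans ?_
      have h3 := mul_le_mul_of_nonneg_left h1 (inv_nonneg.2 (hq_pos (t + 1) ω).le)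
      have h4 : (q (t + 1) ω)⁻¹ * (1 + β t ω) = (q t ω)⁻¹ := by
        have : 1 + β t ω ≠ 0 := by linarith [hβ_nonneg t ω]
        rw [hq_succ, mul_inv, inv_mul_cancel_right₀ this]
      refine h3.trans_eq ?_
      rw [← h4]
      ring)
  filter_upwards [hdisc] with ω hω ⟨hβω, hξω⟩
  have hq_mono : Monotone fun t => q t ω := monotone_nat_of_le_succ fun t => by
    rw [hq_succ]
    exact le_mul_of_one_le_right (hq_pos t ω).le (by linarith [hβ_nonneg t ω])
  have hq_le (t : ℕ) : q t ω ≤ Real.exp (∑' s, β s ω) := by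
    calc q t ω ≤ ∏ s ∈ Finset.range t, Real.exp (β s ω) :=
          Finset.prod_le_prod (fun s _ => by linarith [hβ_nonneg s ω])
            fun s _ => by linarith [Real.add_one_le_exp (β s ω)]
      _ = Real.exp (∑ s ∈ Finset.range t, β s ω) := (Real.exp_sum _ _).symm
      _ ≤ _ := Real.exp_le_exp.2 (hβω.sum_le_tsum _ fun s _ => hβ_nonneg s ω)
  have hq_tendsto : Tendsto (fun t => q t ω) atTop (𝓝 (⨆ t, q t ω)) :=
    tendsto_atTop_ciSup hq_mono ⟨_, by rintro _ ⟨t, rfl⟩; exact hq_le t⟩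
  obtain ⟨⟨l, hl⟩, hζω⟩ := hω <| hξω.of_nonneg_of_le
    (fun t => mul_nonneg (inv_nonneg.2 (hq_pos _ ω).le) (hξ_nonneg t ω))
    fun t => mul_le_of_le_one_left (hξ_nonneg t ω) (inv_le_one_of_one_le₀ (hq_one _ ω))
  refine ⟨⟨_, (hq_tendsto.mul hl).congr fun t => mul_inv_cancel_left₀ (hq_pos t ω).ne' _⟩, ?_⟩
  refine (hζω.mul_left (Real.exp (∑' s, β s ω))).of_nonneg_of_le (hζ_nonneg · ω) fun t => ?_
  calc ζ t ω = q (t + 1) ω * ((q (t + 1) ω)⁻¹ * ζ t ω) :=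
        (mul_inv_cancel_left₀ (hq_pos (t + 1) ω).ne' _).symm
    _ ≤ _ := mul_le_mul_of_nonneg_right (hq_le (t + 1))
        (mul_nonneg (inv_nonneg.2 (hq_pos _ ω).le) (hζ_nonneg t ω))
end

section
/- Under conditions (C.1)–(C.6), together with the assumption that C is non-negative, the iterates w_t converge to the unique minimizer w* almost surely; in particular C(w_t) → C(w*) and ∇C(w_t) → 0 almost surely as t → ∞. -/
open MeasureTheory Filter
open scoped Topology RealInnerProductSpace

section Deterministic

variable {E : Type*} [NormedAddCommGroup E] [InnerProductSpace ℝ E]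

/-- A symmetric operator whose quadratic form lies between `0` and `M * ‖v‖ ^ 2` has norm at
most `M`. -/
lemma norm_apply_le_of_inner_le {T : E →L[ℝ] E} {M : ℝ} (hM : 0 < M)
    (hsymm : ∀ u v, ⟪T u, v⟫ = ⟪u, T v⟫) (h0 : ∀ v, 0 ≤ ⟪v, T v⟫)
    (h1 : ∀ v, ⟪v, T v⟫ ≤ M * ‖v‖ ^ 2) (v : E) : ‖T v‖ ≤ M * ‖v‖ := by
  have hplus := h1 (M⁻¹ • T v + v)
  have hminus := h0 (M⁻¹ • T v - v)
  have hpar := parallelogram_law_with_norm ℝ (M⁻¹ • T v) v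
  have e : ⟪v, T (M⁻¹ • T v)⟫ = M⁻¹ * ‖T v‖ ^ 2 := by
    rw [← hsymm, real_inner_smul_right, real_inner_self_eq_norm_sq]
  have e' : ⟪M⁻¹ • T v, T v⟫ = M⁻¹ * ‖T v‖ ^ 2 := by
    rw [real_inner_smul_left, real_inner_self_eq_norm_sq]
  simp only [map_add, map_sub, inner_add_left, inner_add_right, inner_sub_left, inner_sub_right,
    e, e'] at hplus hminus
  rw [norm_smul, Real.norm_of_nonneg (inv_nonneg.2 hM.le)] at hpar
  have h4 : 4 * (M⁻¹ * ‖T v‖ ^ 2) ≤ 2 * M * ((M⁻¹ * ‖T v‖) ^ 2 + ‖v‖ ^ 2) := by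
    have : 0 ≤ M * ‖M⁻¹ • T v - v‖ ^ 2 := by positivity
    nlinarith
  have h5 : M * (M⁻¹ * ‖T v‖) ^ 2 = M⁻¹ * ‖T v‖ ^ 2 := by field_simp
  have h6 : M⁻¹ * ‖T v‖ ^ 2 ≤ M * ‖v‖ ^ 2 := by linarith
  rw [inv_mul_le_iff₀ hM] at h6
  exact abs_le_of_sq_le_sq' (by linarith [mul_pow M ‖v‖ 2]) (by positivity) |>.2

variable [CompleteSpace E] {C : E → ℝ} {L : NNReal}

/-- Quadratic upper bound for a differentiable function with Lipschitz gradient. -/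
lemma LipschitzWith.apply_add_le_of_gradient (hC : Differentiable ℝ C)
    (hL : LipschitzWith L (gradient C)) (x h : E) :
    C (x + h) ≤ C x + ⟪gradient C x, h⟫ + L * ‖h‖ ^ 2 := by
  have key := (convex_closedBall x ‖h‖).norm_image_sub_le_of_norm_fderiv_le' (𝕜 := ℝ)
    (f := C) (φ := fderiv ℝ C x) (C := L * ‖h‖) (x := x) (y := x + h)
    (fun z _ => hC z) (fun z hz => ?_) (by simp) (by simp)
  · rw [add_sub_cancel_left, ← inner_gradient_left, Real.norm_eq_abs] at key
    nlinarith [le_abs_self (C (x + h) - C x - ⟪gradient C x, h⟫)]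
  · rw [← toDual_gradient, ← toDual_gradient, ← map_sub, LinearIsometryEquiv.norm_map]
    exact (hL.norm_sub_le z x).trans
      (mul_le_mul_of_nonneg_left (by simpa [dist_eq_norm] using hz) L.2)

lemma LipschitzWith.apply_sub_smul_gradient_le (hC : Differentiable ℝ C)
    (hL : LipschitzWith L (gradient C)) (x : E) {s : ℝ} (hs : 0 ≤ s) (hsL : L * s ≤ 1 / 2) :
    C (x - s • gradient C x) ≤ C x - s / 2 * ‖gradient C x‖ ^ 2 := by
  have h := hL.apply_add_le_of_gradient hC x (-(s • gradient C x))
  rw [← sub_eq_add_neg, inner_neg_right, real_inner_smul_right, real_inner_self_eq_norm_sq,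
    norm_neg, norm_smul, Real.norm_of_nonneg hs, mul_pow] at h
  nlinarith [mul_nonneg hs (sq_nonneg ‖gradient C x‖)]

lemma gradient_eq_zero_of_forall_le {x : E} (hx : ∀ y, C x ≤ C y) : gradient C x = 0 := by
  have h : IsLocalMin C x := Eventually.of_forall hx
  rw [gradient, h.fderiv_eq_zero, map_zero]

/-- If the gradient is Lipschitz and bounded away from zero above every level strictly greater
than the minimum, then the small sublevel sets shrink to the minimizer. The proof flows the segment
from the minimizer to a hypothetical far away point of small cost by gradient descent steps into a
sublevel set which is separated by a sphere. -/
lemma exists_sublevel_subset_ball [ProperSpace E] (hC : Differentiable ℝ C)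
    (hL : LipschitzWith L (gradient C)) {x₀ : E} (hmin : ∀ v, C x₀ ≤ C v)
    (huniq : ∀ v, (∀ u, C v ≤ C u) → v = x₀)
    (hgrad : ∀ δ : ℝ, 0 < δ → ∃ c > 0, ∀ v, C v - C x₀ > δ → c ≤ ‖gradient C v‖)
    {r : ℝ} (hr : 0 < r) : ∃ δ > 0, ∀ v, C v ≤ C x₀ + δ → ‖v - x₀‖ < r := by
  have hpos : ∀ v ∈ Metric.sphere x₀ r, C x₀ < C v := fun v hv =>
    lt_of_le_of_ne (hmin v) fun h => by
      have := huniq v fun u => h ▸ hmin u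
      simp [this, hr.ne] at hv
  obtain ⟨A, hA, hAS⟩ := (isCompact_sphere x₀ r).exists_forall_le' hC.continuous.continuousOn hpos
  set δ : ℝ := (A - C x₀) / 2 with hδ
  have hδ0 : 0 < δ := by linarith
  have hsphere : ∀ v, ‖v - x₀‖ = r → ¬ C v ≤ C x₀ + δ := fun v hv h => by
    have := hAS v (by simpa [dist_eq_norm] using hv)
    linarith
  refine ⟨δ, hδ0, fun v hv => ?_⟩
  by_contra! hvr
  obtain ⟨c, hc, hcg⟩ := hgrad δ hδ0
  set η : ℝ := 1 / (2 * (L + 1)) with hη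
  have hη0 : 0 < η := by positivity
  have hηL : L * η ≤ 1 / 2 := by
    rw [hη, mul_one_div, div_le_div_iff₀ (by positivity) two_pos]
    linarith
  let G : E → E := fun x => x - η • gradient C x
  have hGcont : Continuous G := by
    have := hL.continuous
    fun_prop
  have hGle : ∀ x, C (G x) ≤ C x - η / 2 * ‖gradient C x‖ ^ 2 := fun x =>
    hL.apply_sub_smul_gradient_le hC x hη0.le hηL
  have hG₀ : G x₀ = x₀ := by simp [G, gradient_eq_zero_of_forall_le hmin]
  have houtside : ∀ N : ℕ, C (G^[N] v) ≤ C x₀ + δ ∧ r ≤ ‖G^[N] v - x₀‖ := by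
    intro N
    induction N with
    | zero => exact ⟨hv, hvr⟩
    | succ N ih =>
      rw [Function.iterate_succ_apply']
      set x := G^[N] v
      have hstep : ∀ s ∈ Set.Icc 0 η, C (x - s • gradient C x) ≤ C x₀ + δ := fun s hs => by
        have := hL.apply_sub_smul_gradient_le hC x hs.1
          ((mul_le_mul_of_nonneg_left hs.2 L.2).trans hηL)
        have := mul_nonneg hs.1 (sq_nonneg ‖gradient C x‖)
        linarith [ih.1]
      refine ⟨hstep η ⟨hη0.le, le_rfl⟩, ?_⟩
      by_contra! hlt
      obtain ⟨s, hs, hsr⟩ := intermediate_value_Icc' hη0.le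
        (f := fun s : ℝ => ‖x - s • gradient C x - x₀‖) (by fun_prop)
        (show r ∈ _ from ⟨hlt.le, by simpa using ih.2⟩)
      exact hsphere _ hsr (hstep s hs)
  set κ : ℝ := η / 2 * c ^ 2 with hκ
  have hκ0 : 0 < κ := by positivity
  have hdecr : ∀ (N : ℕ) x, C (G^[N] x) ≤ max (C x₀ + δ) (C x - N * κ) := by
    intro N x
    induction N with
    | zero => simp
    | succ N ih =>
      rw [Function.iterate_succ_apply']
      set y := G^[N] x
      by_cases hy : C y ≤ C x₀ + δ
      · refine le_max_of_le_left ((hGle y).trans ?_)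
        have : 0 ≤ η / 2 * ‖gradient C y‖ ^ 2 := by positivity
        linarith
      · have h1 : C y ≤ C x - N * κ := (le_max_iff.1 ih).resolve_left hy
        have h2 : c ^ 2 ≤ ‖gradient C y‖ ^ 2 :=
          pow_le_pow_left₀ hc.le (hcg y (by linarith)) 2
        have h3 : κ ≤ η / 2 * ‖gradient C y‖ ^ 2 := mul_le_mul_of_nonneg_left h2 (by positivity)
        refine le_max_of_le_right ?_
        push_cast
        linarith [hGle y]
  have hpath : Continuous fun s : ℝ => AffineMap.lineMap (k := ℝ) x₀ v s := by fun_prop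
  obtain ⟨b, hb⟩ := (isCompact_Icc (a := (0 : ℝ)) (b := 1)).bddAbove_image
    (hC.continuous.comp hpath).continuousOn
  obtain ⟨N, hN⟩ := exists_nat_ge ((b - (C x₀ + δ)) / κ)
  rw [div_le_iff₀ hκ0] at hN
  obtain ⟨s, hs, hsr⟩ := intermediate_value_Icc (zero_le_one' ℝ)
    (f := fun s : ℝ => ‖G^[N] (AffineMap.lineMap (k := ℝ) x₀ v s) - x₀‖)
    ((((hGcont.iterate N).comp hpath).sub continuous_const).norm.continuousOn)
    (show r ∈ _ from ⟨by simpa [Function.iterate_fixed hG₀] using hr.le,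
      by simpa using (houtside N).2⟩)
  refine hsphere _ hsr ((hdecr N _).trans (max_le le_rfl ?_))
  have : C (AffineMap.lineMap (k := ℝ) x₀ v s) ≤ b := hb ⟨s, hs, rfl⟩
  linarith

end Deterministic

section Probability

variable {Ω : Type*} {m0 : MeasurableSpace Ω} {μ : Measure Ω} [IsFiniteMeasure μ]
  {ℱ : Filtration ℕ m0}

/-- A nonnegative supermartingale converges almost surely. -/
lemma MeasureTheory.Supermartingale.ae_exists_tendsto_of_nonneg {Z : ℕ → Ω → ℝ}
    (hZ : Supermartingale Z ℱ μ) (h0 : ∀ t ω, 0 ≤ Z t ω) :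
    ∀ᵐ ω ∂μ, ∃ c, Tendsto (fun t => Z t ω) atTop (𝓝 c) := by
  have hbdd : ∀ t, eLpNorm ((-Z) t) 1 μ ≤ (∫ ω, Z 0 ω ∂μ).toNNReal := fun t => by
    rw [Pi.neg_apply, eLpNorm_neg, eLpNorm_one_eq_lintegral_enorm,
      ← ofReal_integral_norm_eq_lintegral_enorm (hZ.integrable t)]
    refine ENNReal.ofReal_le_ofReal ?_
    simp_rw [Real.norm_of_nonneg (h0 t _)]
    simpa using hZ.setIntegral_le (Nat.zero_le t) MeasurableSet.univ
  filter_upwards [hZ.neg.ae_tendsto_limitProcess hbdd] with ω hω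
  exact ⟨_, by simpa using hω.neg⟩

lemma ae_tendsto_and_summable_of_condExp_le_sub {Z h : ℕ → Ω → ℝ}
    (hZm : StronglyAdapted ℱ Z) (hhm : StronglyAdapted ℱ h)
    (hZi : ∀ t, Integrable (Z t) μ) (hhi : ∀ t, Integrable (h t) μ)
    (hZ0 : ∀ t ω, 0 ≤ Z t ω) (hh0 : ∀ t ω, 0 ≤ h t ω)
    (hle : ∀ t, μ[Z (t + 1) | ℱ t] ≤ᵐ[μ] fun ω => Z t ω - h t ω) :
    ∀ᵐ ω ∂μ, (∃ c, Tendsto (fun t => Z t ω) atTop (𝓝 c)) ∧ Summable fun t => h t ω := by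
  have hZ : Supermartingale Z ℱ μ := supermartingale_nat hZm hZi fun t => by
    filter_upwards [hle t] with ω hω
    linarith [hh0 t ω]
  have hHm : ∀ t s, s ≤ t + 1 →
      StronglyMeasurable[ℱ t] (∑ i ∈ Finset.range s, h i) := fun t s hs =>
    Finset.stronglyMeasurable_sum _ fun i hi =>
      (hhm i).mono (ℱ.mono (by have := Finset.mem_range.1 hi; omega))
  have hHi : ∀ s, Integrable (∑ i ∈ Finset.range s, h i) μ := fun s =>
    integrable_finsetSum' _ fun i _ => hhi i
  have hS : Supermartingale (fun t => Z t + ∑ i ∈ Finset.range t, h i) ℱ μ := by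
    refine supermartingale_nat (fun t => (hZm t).add (hHm t t (by omega)))
      (fun t => (hZi t).add (hHi t)) fun t => ?_
    have hadd := condExp_add (hZi (t + 1)) (hHi (t + 1)) (ℱ t)
    rw [condExp_of_stronglyMeasurable (ℱ.le t) (hHm t (t + 1) le_rfl) (hHi _)] at hadd
    filter_upwards [hadd, hle t] with ω h1 h2
    rw [h1]
    simp only [Pi.add_apply, Finset.sum_range_succ]
    linarith
  filter_upwards [hZ.ae_exists_tendsto_of_nonneg hZ0,
    hS.ae_exists_tendsto_of_nonneg fun t ω => add_nonneg (hZ0 t ω) (by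
      rw [Finset.sum_apply]; exact Finset.sum_nonneg fun i _ => hh0 i ω)] with ω ⟨c, hc⟩ ⟨d, hd⟩
  refine ⟨⟨c, hc⟩, ((hasSum_iff_tendsto_nat_of_nonneg (fun i => hh0 i ω) (d - c)).2 ?_).summable⟩
  simpa using hd.sub hc

/-- The Robbins-Siegmund theorem, for deterministic perturbation factors. -/
lemma ae_tendsto_and_summable_of_condExp_le {V g : ℕ → Ω → ℝ} {b : ℕ → ℝ}
    (hVm : StronglyAdapted ℱ V) (hgm : StronglyAdapted ℱ g)
    (hVi : ∀ t, Integrable (V t) μ) (hgi : ∀ t, Integrable (g t) μ)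
    (hV0 : ∀ t ω, 0 ≤ V t ω) (hg0 : ∀ t ω, 0 ≤ g t ω)
    (hb0 : ∀ t, 0 ≤ b t) (hb : Summable b)
    (hle : ∀ t, μ[V (t + 1) | ℱ t] ≤ᵐ[μ] fun ω => (1 + b t) * V t ω - g t ω) :
    ∀ᵐ ω ∂μ, (∃ c, Tendsto (fun t => V t ω) atTop (𝓝 c)) ∧ Summable fun t => g t ω := by
  set P : ℕ → ℝ := fun t => ∏ i ∈ Finset.range t, (1 + b i) with hP
  have hP0 : ∀ t, 0 < P t := fun t => Finset.prod_pos fun i _ => by linarith [hb0 i]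
  have hPsucc : ∀ t, P (t + 1) = P t * (1 + b t) := fun t => Finset.prod_range_succ _ _
  have hPlim : Tendsto P atTop (𝓝 (∏' i, (1 + b i))) :=
    (Real.multipliable_one_add_of_summable hb).hasProd.tendsto_prod_nat
  obtain ⟨q, hq⟩ := hPlim.bddAbove_range
  have key := ae_tendsto_and_summable_of_condExp_le_sub (ℱ := ℱ) (μ := μ)
    (Z := fun t => (P t)⁻¹ • V t) (h := fun t => (P (t + 1))⁻¹ • g t)
    (fun t => (hVm t).const_smul _) (fun t => (hgm t).const_smul _)
    (fun t => (hVi t).smul _) (fun t => (hgi t).smul _)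
    (fun t ω => mul_nonneg (inv_nonneg.2 (hP0 t).le) (hV0 t ω))
    (fun t ω => mul_nonneg (inv_nonneg.2 (hP0 _).le) (hg0 t ω)) fun t => by
      filter_upwards [condExp_smul (μ := μ) (P (t + 1))⁻¹ (V (t + 1)) (ℱ t), hle t] with ω h1 h2
      rw [h1]
      simp only [Pi.smul_apply, smul_eq_mul]
      refine (mul_le_mul_of_nonneg_left h2 (inv_nonneg.2 (hP0 _).le)).trans_eq ?_
      have := (hP0 t).ne'
      have h3 : 1 + b t ≠ 0 := by linarith [hb0 t]
      rw [hPsucc]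
      field_simp
  filter_upwards [key] with ω ⟨⟨c, hc⟩, hs⟩
  refine ⟨⟨_, (hPlim.mul hc).congr fun t => ?_⟩,
    (hs.mul_left q).of_nonneg_of_le (hg0 · ω) fun t => ?_⟩
  · simp [(hP0 t).ne']
  · have hPq : P (t + 1) ≤ q := hq ⟨t + 1, rfl⟩
    simp only [Pi.smul_apply, smul_eq_mul]
    rw [← mul_assoc]
    refine le_mul_of_one_le_left (hg0 t ω) ?_
    rwa [← div_eq_mul_inv, one_le_div (hP0 _)]

end Probability

section Step

variable {E : Type*} [NormedAddCommGroup E] [InnerProductSpace ℝ E]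
  {Ω : Type*} {m0 : MeasurableSpace Ω} {μ : Measure Ω}

lemma MeasureTheory.MemLp.integrable_real_inner {f g : Ω → E} (hf : MemLp f 2 μ)
    (hg : MemLp g 2 μ) : Integrable (fun ω => ⟪f ω, g ω⟫) μ := by
  have h : Integrable (fun ω => ‖f ω‖ * ‖g ω‖) μ := hf.norm.integrable_mul hg.norm
  exact h.mono' (hf.1.inner hg.1) (Eventually.of_forall fun ω => norm_inner_le_norm _ _)

lemma MeasureTheory.StronglyMeasurable.clm_apply {m : MeasurableSpace Ω} {T : Ω → E →L[ℝ] E}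
    {y : Ω → E} (hT : StronglyMeasurable[m] T) (hy : StronglyMeasurable[m] y) :
    StronglyMeasurable[m] fun ω => T ω (y ω) :=
  (continuous_fst.clm_apply continuous_snd).comp_stronglyMeasurable (hT.prodMk hy)

lemma MeasureTheory.MemLp.clm_apply_of_norm_le {T : Ω → E →L[ℝ] E} {y : Ω → E} {M : ℝ}
    (hT : StronglyMeasurable T) (hy : StronglyMeasurable y) (hy2 : MemLp y 2 μ)
    (hM : ∀ᵐ ω ∂μ, ∀ v, ‖T ω v‖ ≤ M * ‖v‖) : MemLp (fun ω => T ω (y ω)) 2 μ :=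
  hy2.of_le_mul (hT.clm_apply hy).aestronglyMeasurable (hM.mono fun ω h => h (y ω))

variable [CompleteSpace E] {C : E → ℝ} {L : NNReal} {x₀ : E} {s : Set Ω} {x : Ω → E}

lemma memLp_indicator_gradient (hL : LipschitzWith L (gradient C)) (hmin : ∀ v, C x₀ ≤ C v)
    (hs : MeasurableSet s) (hx : StronglyMeasurable x)
    (hx2 : MemLp (s.indicator fun ω => x ω - x₀) 2 μ) :
    MemLp (s.indicator fun ω => gradient C (x ω)) 2 μ := by
  refine hx2.of_le_mul (c := L)
    ((hL.continuous.comp_stronglyMeasurable hx).indicator hs).aestronglyMeasurable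
    (Eventually.of_forall fun ω => ?_)
  by_cases hω : ω ∈ s
  · simpa [hω, gradient_eq_zero_of_forall_le hmin] using hL.norm_sub_le (x ω) x₀
  · simp [hω]

lemma integrable_indicator_cost [IsFiniteMeasure μ] (hC : Differentiable ℝ C)
    (hL : LipschitzWith L (gradient C))
    (hmin : ∀ v, C x₀ ≤ C v) (hs : MeasurableSet s) (hx : StronglyMeasurable x)
    (hx2 : MemLp (s.indicator fun ω => x ω - x₀) 2 μ) :
    Integrable (s.indicator fun ω => C (x ω) - C x₀ + 1) μ := by
  have h : Integrable (fun ω => L * ‖s.indicator (fun ω => x ω - x₀) ω‖ ^ 2 + 1) μ :=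
    (hx2.integrable_norm_pow two_ne_zero |>.const_mul _).add (integrable_const _)
  refine h.mono' (((hC.continuous.comp_stronglyMeasurable hx).sub
    stronglyMeasurable_const).add stronglyMeasurable_const |>.indicator hs).aestronglyMeasurable
    (Eventually.of_forall fun ω => ?_)
  by_cases hω : ω ∈ s
  · have h1 := hL.apply_add_le_of_gradient hC x₀ (x ω - x₀)
    rw [gradient_eq_zero_of_forall_le hmin, inner_zero_left, add_sub_cancel] at h1
    simp only [hω, Set.indicator_of_mem]
    rw [Real.norm_of_nonneg (by linarith [hmin (x ω)])]
    linarith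
  · simp [hω]

/-- Drift inequality for one step of variable metric stochastic gradient descent, localized to an
event `s` of the past. -/
lemma condExp_indicator_cost_step_le [IsFiniteMeasure μ] {m : MeasurableSpace Ω} (hm : m ≤ m0)
    (hC : Differentiable ℝ C) (hL : LipschitzWith L (gradient C)) (hmin : ∀ v, C x₀ ≤ C v)
    (hs : MeasurableSet[m] s) (hx : StronglyMeasurable[m] x) {y : Ω → E} {T : Ω → E →L[ℝ] E}
    (hy : StronglyMeasurable[m0] y) (hT : StronglyMeasurable[m] T)
    (hx2 : MemLp (s.indicator fun ω => x ω - x₀) 2 μ) (hy2 : MemLp y 2 μ)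
    (hmean : μ[y | m] =ᵐ[μ] fun ω => gradient C (x ω))
    {A B : ℝ} (hA : 0 ≤ A + B * C x₀) (hB : 0 ≤ B)
    (hsecond : ∀ᵐ ω ∂μ, (μ[fun ω' => ‖y ω'‖ ^ 2 | m]) ω ≤ A + B * C (x ω))
    {lo M : ℝ} (hsymm : ∀ᵐ ω ∂μ, ∀ u v, ⟪T ω u, v⟫ = ⟪u, T ω v⟫)
    (hlo : ∀ᵐ ω ∂μ, ∀ v, lo * ‖v‖ ^ 2 ≤ ⟪v, T ω v⟫)
    (hM : ∀ᵐ ω ∂μ, ∀ v, ‖T ω v‖ ≤ M * ‖v‖) {α : ℝ} (hα : 0 ≤ α)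
    (hx2' : MemLp (s.indicator fun ω => x ω - α • T ω (y ω) - x₀) 2 μ) :
    μ[s.indicator fun ω => C (x ω - α • T ω (y ω)) - C x₀ + 1 | m] ≤ᵐ[μ] fun ω =>
      (1 + L * M ^ 2 * (A + B * C x₀ + B) * α ^ 2) *
          s.indicator (fun ω => C (x ω) - C x₀ + 1) ω -
        α * lo * s.indicator (fun ω => ‖gradient C (x ω)‖ ^ 2) ω := by
  have hs' := hm _ hs
  have hx' := hx.mono hm
  have hT' := hT.mono hm
  set V : Ω → ℝ := s.indicator fun ω => C (x ω) - C x₀ + 1 with hV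
  set u : Ω → E := fun ω => T ω (s.indicator (fun ω => gradient C (x ω)) ω) with hu
  set Q : Ω → ℝ := s.indicator fun ω => ‖y ω‖ ^ 2 with hQ
  have hVm : StronglyMeasurable[m] V := ((hC.continuous.comp_stronglyMeasurable hx).sub
    stronglyMeasurable_const).add stronglyMeasurable_const |>.indicator hs
  have hgm : StronglyMeasurable[m] (s.indicator fun ω => gradient C (x ω)) :=
    (hL.continuous.comp_stronglyMeasurable hx).indicator hs
  have hum : StronglyMeasurable[m] u := hT.clm_apply hgm
  have hVi : Integrable V μ := integrable_indicator_cost hC hL hmin hs' hx' hx2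
  have hui : Integrable (fun ω => ⟪u ω, y ω⟫) μ :=
    (MemLp.clm_apply_of_norm_le hT' (hgm.mono hm)
      (memLp_indicator_gradient hL hmin hs' hx' hx2) hM).integrable_real_inner hy2
  have hyi : Integrable (fun ω => ‖y ω‖ ^ 2) μ := hy2.integrable_norm_pow two_ne_zero
  have hQi : Integrable Q μ := hyi.indicator hs'
  have hbound : s.indicator (fun ω => C (x ω - α • T ω (y ω)) - C x₀ + 1) ≤ᵐ[μ]
      V - α • (fun ω => ⟪u ω, y ω⟫) + (L * α ^ 2 * M ^ 2) • Q := by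
    filter_upwards [hsymm, hM] with ω h1 h2
    simp only [Pi.add_apply, Pi.sub_apply, Pi.smul_apply, smul_eq_mul, hV, hu, hQ]
    by_cases hω : ω ∈ s
    · simp only [hω, Set.indicator_of_mem]
      have h3 := hL.apply_add_le_of_gradient hC (x ω) (-(α • T ω (y ω)))
      rw [← sub_eq_add_neg, inner_neg_right, real_inner_smul_right, norm_neg, norm_smul,
        Real.norm_of_nonneg hα, mul_pow, ← h1] at h3
      have h4 : ‖T ω (y ω)‖ ^ 2 ≤ M ^ 2 * ‖y ω‖ ^ 2 := by
        rw [← mul_pow]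
        exact pow_le_pow_left₀ (norm_nonneg _) (h2 _) 2
      have h5 := mul_le_mul_of_nonneg_left h4 (mul_nonneg L.2 (sq_nonneg α))
      simp only [NNReal.val_eq_coe] at h5
      linarith
    · simp [hω]
  have hmono := condExp_mono (m := m)
    (integrable_indicator_cost hC hL hmin hs'
      (hx'.sub ((hT'.clm_apply hy).const_smul α)) hx2')
    ((hVi.sub (hui.smul α)).add (hQi.smul (L * α ^ 2 * M ^ 2))) hbound
  have hpull : μ[fun ω => ⟪u ω, y ω⟫ | m] =ᵐ[μ] fun ω => ⟪u ω, (μ[y | m]) ω⟫ :=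
    condExp_bilin_of_stronglyMeasurable_left (innerSL ℝ) hum hui (hy2.integrable one_le_two)
  filter_upwards [hmono, condExp_add (hVi.sub (hui.smul α)) (hQi.smul (L * α ^ 2 * M ^ 2)) m,
    condExp_sub hVi (hui.smul α) m, condExp_smul (μ := μ) α (fun ω => ⟪u ω, y ω⟫) m,
    condExp_smul (μ := μ) (L * α ^ 2 * M ^ 2 : ℝ) Q m, condExp_indicator hyi hs,
    hpull,
    hmean, hsecond, hlo, hsymm] with ω h1 h2 h3 h4 h5 h6 h7 h8 h9 h10 h11
  refine h1.trans ?_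
  rw [h2, Pi.add_apply, h3, Pi.sub_apply, h4, h5, Pi.smul_apply, Pi.smul_apply, h6, h7, h8,
    condExp_of_stronglyMeasurable hm hVm hVi]
  simp only [smul_eq_mul, hV, hu]
  by_cases hω : ω ∈ s
  · simp only [hω, Set.indicator_of_mem]
    rw [h11]
    have h12 := mul_le_mul_of_nonneg_left (h10 (gradient C (x ω))) hα
    have h13 : (μ[fun ω' => ‖y ω'‖ ^ 2 | m]) ω ≤
        (A + B * C x₀ + B) * (C (x ω) - C x₀ + 1) := by
      nlinarith [hmin (x ω), mul_nonneg hA (sub_nonneg.2 (hmin (x ω)))]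
    have h14 := mul_le_mul_of_nonneg_left h13
      (mul_nonneg (mul_nonneg L.2 (sq_nonneg α)) (sq_nonneg M))
    simp only [NNReal.val_eq_coe] at h14
    linarith
  · simp [hω]

end Step

/-- If `a` is a nonsummable positive sequence and `∑ a t * ‖∇C (x t)‖ ^ 2` converges, convergence of
the costs forces convergence to the minimum, as the gradient is bounded away from zero above
every larger level. -/
lemma tendsto_cost_of_summable_gradient {E : Type*} [NormedAddCommGroup E]
    [InnerProductSpace ℝ E] [CompleteSpace E] {C : E → ℝ} {x₀ : E} (hmin : ∀ v, C x₀ ≤ C v)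
    (hgrad : ∀ δ : ℝ, 0 < δ → ∃ c > 0, ∀ v, C v - C x₀ > δ → c ≤ ‖gradient C v‖)
    {a : ℕ → ℝ} (ha : ∀ t, 0 < a t) (hns : ¬ Summable a) {x : ℕ → E} {l : ℝ}
    (hl : Tendsto (fun t => C (x t)) atTop (𝓝 l))
    (hsum : Summable fun t => a t * ‖gradient C (x t)‖ ^ 2) :
    Tendsto (fun t => C (x t)) atTop (𝓝 (C x₀)) := by
  have hle : C x₀ ≤ l := ge_of_tendsto' hl fun t => hmin _
  obtain heq | hlt := hle.eq_or_lt
  · rwa [heq]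
  obtain ⟨c, hc, hcg⟩ := hgrad ((l - C x₀) / 2) (by linarith)
  refine absurd ?_ hns
  refine (hsum.mul_left (c ^ 2)⁻¹).of_norm_bounded_eventually_nat ?_
  filter_upwards [hl.eventually_const_lt (show (l + C x₀) / 2 < l by linarith)] with t ht
  rw [Real.norm_of_nonneg (ha t).le, ← mul_assoc, mul_comm _ (a t), mul_assoc]
  refine le_mul_of_one_le_right (ha t).le ?_
  rw [← div_eq_inv_mul, one_le_div (by positivity)]
  exact pow_le_pow_left₀ hc.le (hcg _ (by linarith)) 2

/-- **Almost sure convergence of variable metric stochastic gradient descent**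
(Theorem 2 of the paper). Under conditions (C.1)–(C.6), with `C` non-negative,
the iterates `w (t+1) = w t - a t • B t (Y t)` converge almost surely to the
unique minimizer `w*`; in particular `C (w t) → C w*` and `∇C (w t) → 0`
almost surely. -/
theorem variable_metric_sgd_convergence
    {n : ℕ} {Ω : Type*} {m0 : MeasurableSpace Ω}
    {μ : Measure Ω} [IsProbabilityMeasure μ] (ℱ : Filtration ℕ m0)
    (C : EuclideanSpace ℝ (Fin n) → ℝ)
    (hC : ContDiff ℝ 2 C)
    (hC_nonneg : ∀ v, 0 ≤ C v)
    (wstar : EuclideanSpace ℝ (Fin n))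
    (hmin : ∀ v, C wstar ≤ C v)
    (huniq : ∀ v, (∀ u, C v ≤ C u) → v = wstar)
    (w Y : ℕ → Ω → EuclideanSpace ℝ (Fin n))
    (B : ℕ → Ω → (EuclideanSpace ℝ (Fin n) →L[ℝ] EuclideanSpace ℝ (Fin n)))
    (a : ℕ → ℝ) (ha : ∀ t, 0 < a t)
    (hw_meas : ∀ t, StronglyMeasurable[ℱ t] (w t))
    (hB_meas : ∀ t, StronglyMeasurable[ℱ t] (B t))
    (hY_meas : ∀ t, StronglyMeasurable[ℱ (t + 1)] (Y t))
    (hY_int : ∀ t, Integrable (Y t) μ)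
    (hupdate : ∀ t ω, w (t + 1) ω = w t ω - a t • (B t ω) (Y t ω))
    -- (C.1) unbiased gradient estimates
    (hC1 : ∀ t, μ[Y t | ℱ t] =ᵐ[μ] fun ω => gradient C (w t ω))
    -- (C.2) uniformly bounded Hessian
    (K : ℝ) (hC2 : ∀ v, ‖fderiv ℝ (gradient C) v‖ ≤ 2 * K)
    -- (C.3) gradients bounded away from zero outside sublevel sets
    (hC3 : ∀ δ : ℝ, 0 < δ → ∃ c > 0, ∀ v, C v - C wstar > δ → c ≤ ‖gradient C v‖)
    -- (C.4) second moment bound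
    (A Bc : ℝ) (hA : 0 ≤ A) (hBc : 0 ≤ Bc)
    (hYsq_int : ∀ t, Integrable (fun ω => ‖Y t ω‖ ^ 2) μ)
    (hC4 : ∀ t, ∀ᵐ ω ∂μ,
      (μ[fun ω' => ‖Y t ω'‖ ^ 2 | ℱ t]) ω ≤ A + Bc * C (w t ω))
    -- (C.5) symmetric scaling matrices with uniform spectral bounds
    (m M : ℝ) (hm : 0 < m) (hmM : m < M)
    (hC5 : ∀ t, ∀ᵐ ω ∂μ,
      (∀ u v, ⟪(B t ω) u, v⟫ = ⟪u, (B t ω) v⟫) ∧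
        ∀ v, m * ‖v‖ ^ 2 ≤ ⟪v, (B t ω) v⟫ ∧ ⟪v, (B t ω) v⟫ ≤ M * ‖v‖ ^ 2)
    -- (C.6) step sizes
    (hC6a : Summable fun t => (a t) ^ 2)
    (hC6b : ¬ Summable a) :
    ∀ᵐ ω ∂μ,
      Tendsto (fun t => w t ω) atTop (𝓝 wstar) ∧
      Tendsto (fun t => C (w t ω)) atTop (𝓝 (C wstar)) ∧
      Tendsto (fun t => gradient C (w t ω)) atTop (𝓝 0) := by
  have hCd : Differentiable ℝ C := hC.differentiable (by norm_num)
  have hgd : Differentiable ℝ (gradient C) := by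
    have : ContDiff ℝ 1 (fderiv ℝ C) := hC.fderiv_right (by norm_num)
    exact (InnerProductSpace.toDual ℝ _).symm.differentiable.comp
      (this.differentiable one_ne_zero)
  have hL : LipschitzWith (2 * K).toNNReal (gradient C) :=
    lipschitzWith_of_nnnorm_fderiv_le hgd fun v => NNReal.coe_le_coe.1 <| by
      rw [coe_nnnorm]
      exact (hC2 v).trans (Real.le_coe_toNNReal _)
  set L := (2 * K).toNNReal
  have hM0 : 0 < M := hm.trans hmM
  have hBle : ∀ t, ∀ᵐ ω ∂μ, ∀ v, ‖B t ω v‖ ≤ M * ‖v‖ := fun t => by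
    filter_upwards [hC5 t] with ω h
    exact norm_apply_le_of_inner_le hM0 h.1
      (fun v => (by positivity : (0 : ℝ) ≤ m * ‖v‖ ^ 2).trans (h.2 v).1) fun v => (h.2 v).2
  have hYm : ∀ t, StronglyMeasurable (Y t) := fun t => (hY_meas t).mono (ℱ.le _)
  have hY2 : ∀ t, MemLp (Y t) 2 μ := fun t =>
    (memLp_two_iff_integrable_sq_norm (hYm t).aestronglyMeasurable).2 (hYsq_int t)
  have hwstep : ∀ t, w (t + 1) = fun ω => w t ω - a t • B t ω (Y t ω) := fun t =>
    funext (hupdate t)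
  have hlocal : ∀ R : ℕ, ∀ᵐ ω ∂μ, ‖w 0 ω‖ ≤ R →
      (∃ c, Tendsto (fun t => C (w t ω)) atTop (𝓝 c)) ∧
        Summable fun t => a t * ‖gradient C (w t ω)‖ ^ 2 := by
    intro R
    set s : Set Ω := {ω | ‖w 0 ω‖ ≤ R}
    have hs0 : MeasurableSet[ℱ 0] s :=
      (hw_meas 0).norm.measurableSet_le stronglyMeasurable_const
    have hst : ∀ t, MeasurableSet[ℱ t] s := fun t => ℱ.mono (Nat.zero_le t) _ hs0
    have hs' : MeasurableSet s := ℱ.le 0 _ hs0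
    have hwm : ∀ t, StronglyMeasurable (w t) := fun t => (hw_meas t).mono (ℱ.le t)
    have hw2 : ∀ t, MemLp (s.indicator fun ω => w t ω - wstar) 2 μ := by
      intro t
      induction t with
      | zero =>
        refine MemLp.of_bound (((hwm 0).sub stronglyMeasurable_const).indicator
          hs').aestronglyMeasurable (R + ‖wstar‖) (Eventually.of_forall fun ω => ?_)
        by_cases hω : ω ∈ s
        · simpa [hω] using (norm_sub_le _ _).trans (add_le_add_left hω _)
        · simp only [hω, not_false_eq_true, Set.indicator_of_notMem, norm_zero]
          positivity
      | succ t ih =>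
        have hBY := MemLp.clm_apply_of_norm_le ((hB_meas t).mono (ℱ.le t)) (hYm t) (hY2 t)
          (hBle t)
        refine (ih.sub ((hBY.const_smul (a t)).indicator hs')).ae_eq
          (Eventually.of_forall fun ω => ?_)
        by_cases hω : ω ∈ s
        · simp [hω, hupdate, sub_right_comm]
        · simp [hω]
    have key := ae_tendsto_and_summable_of_condExp_le (ℱ := ℱ) (μ := μ)
      (V := fun t => s.indicator fun ω => C (w t ω) - C wstar + 1)
      (g := fun t => (a t * m) • s.indicator fun ω => ‖gradient C (w t ω)‖ ^ 2)
      (b := fun t => L * M ^ 2 * (A + Bc * C wstar + Bc) * a t ^ 2)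
      (fun t => ((hCd.continuous.comp_stronglyMeasurable (hw_meas t)).sub
        stronglyMeasurable_const).add stronglyMeasurable_const |>.indicator (hst t))
      (fun t => (((hL.continuous.comp_stronglyMeasurable (hw_meas t)).norm.pow 2).indicator
        (hst t)).const_smul _)
      (fun t => integrable_indicator_cost hCd hL hmin hs' (hwm t) (hw2 t))
      (fun t => Integrable.smul _ <| by
        convert (memLp_indicator_gradient hL hmin hs' (hwm t) (hw2 t)).integrable_norm_pow
          two_ne_zero using 1
        ext1 ω
        by_cases hω : ω ∈ s <;> simp [hω])
      (fun t => Set.indicator_nonneg fun ω _ => by linarith [hmin (w t ω)])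
      (fun t ω => mul_nonneg (mul_pos (ha t) hm).le
        (Set.indicator_nonneg (fun ω _ => sq_nonneg _) ω))
      (fun t => by
        have := hC_nonneg wstar
        positivity)
      (hC6a.mul_left _) fun t => by
        have hnext := hw2 (t + 1)
        simp only [hwstep] at hnext ⊢
        exact condExp_indicator_cost_step_le (ℱ.le t) hCd hL hmin (hst t) (hw_meas t) (hYm t)
          (hB_meas t) (hw2 t) (hY2 t) (hC1 t)
          (add_nonneg hA (mul_nonneg hBc (hC_nonneg wstar))) hBc (hC4 t)
          ((hC5 t).mono fun ω h => h.1) ((hC5 t).mono fun ω h v => (h.2 v).1) (hBle t)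
          (ha t).le hnext
    filter_upwards [key] with ω ⟨⟨c, hc⟩, hsum⟩ hω
    replace hω : ω ∈ s := hω
    simp only [hω, Set.indicator_of_mem, Pi.smul_apply, smul_eq_mul] at hc hsum
    refine ⟨⟨c - 1 + C wstar, ?_⟩, ?_⟩
    · simpa using (hc.sub_const 1).add_const (C wstar)
    · refine (hsum.mul_left m⁻¹).congr fun t => ?_
      field_simp
  filter_upwards [ae_all_iff.2 hlocal] with ω hω
  obtain ⟨R, hR⟩ := exists_nat_ge ‖w 0 ω‖
  obtain ⟨⟨c, hc⟩, hsum⟩ := hω R hR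
  have hcost := tendsto_cost_of_summable_gradient hmin hC3 ha hC6b hc hsum
  have hw : Tendsto (fun t => w t ω) atTop (𝓝 wstar) := by
    refine Metric.tendsto_nhds.2 fun r hr => ?_
    obtain ⟨δ, hδ, hball⟩ := exists_sublevel_subset_ball hCd hL hmin huniq hC3 hr
    filter_upwards [hcost.eventually_lt_const (lt_add_of_pos_right _ hδ)] with t ht
    rw [dist_eq_norm]
    exact hball _ ht.le
  refine ⟨hw, hcost, ?_⟩
  have := (hL.continuous.tendsto wstar).comp hw
  rwa [gradient_eq_zero_of_forall_le hmin] at this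
end

section
/- Assume conditions (C.1)–(C.6) hold with B = 0 in (C.4) and C non-negative, assume additionally that (C(w_t) − C(w*))/‖∇C(w_t)‖² ≤ D < ∞ almost surely for all t, and take step sizes a_t = τ/t with τ > D/m. Then the expected suboptimality decays at rate 1/t; precisely, limsup_{t→∞} t·(E[C(w_t)] − C(w*)) ≤ A K M² τ² / (τ m / D − 1), so that E[C(w_t)] − C(w*) = O(1/t). -/
open MeasureTheory Filter
open scoped Topology RealInnerProductSpace

/-- A symmetric operator whose quadratic form takes values in `[0, M]` on the unit sphere has
norm at most `M`. -/
theorem norm_apply_le_of_symmetric_of_inner_le {E : Type*} [NormedAddCommGroup E]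
    [InnerProductSpace ℝ E] {T : E →L[ℝ] E} {M : ℝ} (hM : 0 < M)
    (hsymm : ∀ u v, ⟪T u, v⟫ = ⟪u, T v⟫) (hnonneg : ∀ v, 0 ≤ ⟪v, T v⟫)
    (hle : ∀ v, ⟪v, T v⟫ ≤ M * ‖v‖ ^ 2) (u : E) : ‖T u‖ ≤ M * ‖u‖ := by
  have h := hnonneg (M • u - T u)
  have hTu : ⟪u, T (T u)⟫ = ‖T u‖ ^ 2 := by rw [← hsymm, real_inner_self_eq_norm_sq]
  simp only [map_sub, map_smul, inner_sub_left, inner_sub_right, real_inner_smul_left,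
    real_inner_smul_right, hTu, real_inner_self_eq_norm_sq] at h
  refine abs_le_of_sq_le_sq' ?_ (by positivity) |>.2
  nlinarith [mul_le_mul_of_nonneg_left (hle u) (sq_nonneg M), hle (T u)]

/-- The descent lemma: a function whose gradient has derivative bounded by `2 * K` is bounded above
by its first-order expansion plus `K * ‖h‖ ^ 2`. -/
theorem le_add_inner_gradient_add_sq {E : Type*} [NormedAddCommGroup E] [InnerProductSpace ℝ E]
    [CompleteSpace E] {f : E → ℝ} (hf : Differentiable ℝ f)
    (hgrad : Differentiable ℝ (gradient f)) {K : ℝ}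
    (hK : ∀ v, ‖fderiv ℝ (gradient f) v‖ ≤ 2 * K) (x h : E) :
    f (x + h) ≤ f x + ⟪gradient f x, h⟫ + K * ‖h‖ ^ 2 := by
  have hlip (s : ℝ) (hs : 0 ≤ s) : ⟪gradient f (x + s • h) - gradient f x, h⟫
      ≤ 2 * K * s * ‖h‖ ^ 2 := by
    have h1 := convex_univ.norm_image_sub_le_of_norm_fderiv_le (𝕜 := ℝ)
      (fun y _ => hgrad y) (fun y _ => hK y) (Set.mem_univ x) (Set.mem_univ (x + s • h))
    rw [add_sub_cancel_left, norm_smul, Real.norm_of_nonneg hs] at h1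
    calc _ ≤ ‖gradient f (x + s • h) - gradient f x‖ * ‖h‖ := real_inner_le_norm _ _
      _ ≤ (2 * K * (s * ‖h‖)) * ‖h‖ := by gcongr
      _ = _ := by ring
  have hder (s : ℝ) : HasDerivAt
      (fun s : ℝ => f (x + s • h) - s * ⟪gradient f x, h⟫ - K * ‖h‖ ^ 2 * s ^ 2)
      (⟪gradient f (x + s • h), h⟫ - 1 * ⟪gradient f x, h⟫
        - K * ‖h‖ ^ 2 * ((2 : ℕ) * s ^ (2 - 1))) s := by
    have h1 : HasDerivAt (fun s : ℝ => x + s • h) ((1 : ℝ) • h) s :=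
      ((hasDerivAt_id s).smul_const h).const_add x
    have h2 := (hf (x + s • h)).hasGradientAt.hasFDerivAt.comp_hasDerivAt s h1
    rw [one_smul, InnerProductSpace.toDual_apply_apply] at h2
    exact (h2.sub ((hasDerivAt_id s).mul_const _)).sub ((hasDerivAt_pow 2 s).const_mul _)
  have hanti := antitoneOn_of_hasDerivWithinAt_nonpos (convex_Icc (0 : ℝ) 1)
    (fun s _ => (hder s).continuousAt.continuousWithinAt)
    (fun s _ => (hder s).hasDerivWithinAt) (fun s hs => by
      have := hlip s (interior_subset hs).1
      rw [inner_sub_left] at this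
      rw [Nat.cast_ofNat, show 2 - 1 = 1 from rfl, pow_one]
      linarith)
  have := hanti (Set.left_mem_Icc.2 zero_le_one) (Set.right_mem_Icc.2 zero_le_one) zero_le_one
  simp only [one_smul, zero_smul, add_zero] at this
  linarith

/-- A nonnegative sequence contracted by factors `1 - g k` with `∑ g k = ∞` tends to zero. -/
theorem tendsto_zero_of_le_one_sub_mul {y g : ℕ → ℝ} (hy : ∀ k, 0 ≤ y k)
    (hg : Tendsto (fun k => ∑ i ∈ Finset.range k, g i) atTop atTop)
    (hstep : ∀ᶠ k in atTop, y (k + 1) ≤ (1 - g k) * y k) : Tendsto y atTop (𝓝 0) := by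
  obtain ⟨N, hN⟩ := eventually_atTop.1 hstep
  set G : ℕ → ℝ := fun k => ∑ i ∈ Finset.range k, g i with hG
  have hbound : ∀ k ≥ N, y k ≤ y N * Real.exp (G N) * Real.exp (-G k) := by
    intro k hk
    induction k, hk using Nat.le_induction with
    | base => rw [mul_assoc, ← Real.exp_add]; simp
    | succ k hk ih =>
      have hexp : 1 - g k ≤ Real.exp (-g k) := by linarith [Real.add_one_le_exp (-g k)]
      calc y (k + 1) ≤ (1 - g k) * y k := hN k hk
        _ ≤ Real.exp (-g k) * (y N * Real.exp (G N) * Real.exp (-G k)) :=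
          mul_le_mul hexp ih (hy k) (Real.exp_pos _).le
        _ = y N * Real.exp (G N) * Real.exp (-G (k + 1)) := by
          rw [mul_left_comm, ← Real.exp_add, hG]
          simp only [Finset.sum_range_succ]
          ring_nf
  have hlim : Tendsto (fun k => y N * Real.exp (G N) * Real.exp (-G k)) atTop (𝓝 0) := by
    simpa using (Real.tendsto_exp_neg_atTop_nhds_zero.comp hg).const_mul (y N * Real.exp (G N))
  exact squeeze_zero' (.of_forall hy) (eventually_atTop.2 ⟨N, hbound⟩) hlim

/-- Chung's lemma: a nonnegative sequence with `b (t + 1) ≤ (1 - β / t) * b t + c / t ^ 2` and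
`1 < β` satisfies `limsup t * b t ≤ c / (β - 1)`. -/
theorem limsup_natCast_mul_le_of_le_one_sub_div_mul_add {b : ℕ → ℝ} {β c : ℝ} (hβ : 1 < β)
    (hc : 0 ≤ c) (hb : ∀ t, 0 ≤ b t)
    (hstep : ∀ t : ℕ, 1 ≤ t → b (t + 1) ≤ (1 - β / t) * b t + c / t ^ 2) :
    limsup (fun t : ℕ => (t : ℝ) * b t) atTop ≤ c / (β - 1) := by
  set L := c / (β - 1) with hL
  have hLc : L * (β - 1) = c := div_mul_cancel₀ _ (by linarith)
  set y : ℕ → ℝ := fun k => k * max (b (k + 1) - L / k) 0 with hy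
  have hsum : Tendsto (fun k => ∑ i ∈ Finset.range k, (β - 1) * (1 / (i : ℝ))) atTop atTop := by
    simp_rw [← Finset.mul_sum]
    refine Tendsto.const_mul_atTop (by linarith) ?_
    exact (not_summable_iff_tendsto_nat_atTop_of_nonneg fun n => by positivity).1
      Real.not_summable_one_div_natCast
  have hy0 : Tendsto y atTop (𝓝 0) := by
    refine tendsto_zero_of_le_one_sub_mul (fun k => by positivity) hsum ?_
    filter_upwards [eventually_ge_atTop 1, eventually_ge_atTop ⌈β⌉₊] with k hk hkβ
    have hk' : (1 : ℝ) ≤ k := by exact_mod_cast hk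
    have hkβ' : β ≤ k := Nat.ceil_le.1 hkβ
    have h1 := hstep (k + 1) (by lia)
    simp only [hy]
    push_cast at h1 ⊢
    have hrhs : (1 - (β - 1) * (1 / (k : ℝ))) * (k * max (b (k + 1) - L / k) 0)
        = (k + 1 - β) * max (b (k + 1) - L / k) 0 := by
      field_simp
      ring
    have hid : (k + 1 : ℝ) * ((1 - β / (k + 1)) * b (k + 1) + c / (k + 1) ^ 2 - L / (k + 1))
        = (k + 1 - β) * (b (k + 1) - L / k) - c / (k * (k + 1)) := by
      rw [← hLc]
      field_simp
      ring
    have hpos : 0 ≤ c / ((k : ℝ) * (k + 1)) := by positivity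
    rw [hrhs, mul_max_of_nonneg _ _ (by positivity), mul_zero]
    refine max_le ?_ (mul_nonneg (by linarith) (le_max_right _ _))
    calc _ ≤ (k + 1 : ℝ) * ((1 - β / (k + 1)) * b (k + 1) + c / (k + 1) ^ 2 - L / (k + 1)) := by
          gcongr
      _ ≤ (k + 1 - β) * (b (k + 1) - L / k) := by linarith
      _ ≤ _ := mul_le_mul_of_nonneg_left (le_max_left _ _) (by linarith)
  have hinv : Tendsto (fun k : ℕ => 1 + 1 / (k : ℝ)) atTop (𝓝 1) := by
    simpa using tendsto_one_div_atTop_nhds_zero_nat.const_add (1 : ℝ)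
  have hlim : Tendsto (fun k : ℕ => (1 + 1 / (k : ℝ)) * (L + y k)) atTop (𝓝 L) := by
    simpa using hinv.mul (hy0.const_add L)
  rw [← limsup_nat_add _ 1, ← hlim.limsup_eq]
  refine limsup_le_limsup ?_ ?_ hlim.isBoundedUnder_le
  · filter_upwards [eventually_ge_atTop 1] with k hk
    have hk' : (0 : ℝ) < k := by exact_mod_cast hk
    have hle : b (k + 1) ≤ L / k + max (b (k + 1) - L / k) 0 := by
      linarith [le_max_left (b (k + 1) - L / k) 0]
    calc ((k + 1 : ℕ) : ℝ) * b (k + 1)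
        ≤ ((k + 1 : ℕ) : ℝ) * (L / k + max (b (k + 1) - L / k) 0) := by gcongr
      _ = _ := by
        simp only [hy]
        push_cast
        field_simp
  · exact (isBoundedUnder_of ⟨0, fun k => mul_nonneg (Nat.cast_nonneg _) (hb _)⟩ :
      IsBoundedUnder (· ≥ ·) atTop _).isCoboundedUnder_le

/-- The mean inner product of a square-integrable `Y` with an `m`-measurable square-integrable `Z`
only depends on the conditional expectation of `Y`. -/
theorem integral_inner_condExp_right {Ω E : Type*} {m m0 : MeasurableSpace Ω} (hm : m ≤ m0)
    {μ : Measure Ω} [IsFiniteMeasure μ] [NormedAddCommGroup E] [InnerProductSpace ℝ E]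
    [CompleteSpace E] {Z Y : Ω → E} (hZ : StronglyMeasurable[m] Z) (hZ2 : MemLp Z 2 μ)
    (hY : MemLp Y 2 μ) :
    Integrable (fun ω => ⟪Z ω, Y ω⟫) μ ∧
      ∫ ω, ⟪Z ω, (μ[Y | m]) ω⟫ ∂μ = ∫ ω, ⟪Z ω, Y ω⟫ ∂μ := by
  have hinner : Integrable (fun ω => ⟪Z ω, Y ω⟫) μ := by
    refine (hZ2.norm.integrable_mul hY.norm).mono'
      (hZ2.aestronglyMeasurable.inner hY.aestronglyMeasurable) (.of_forall fun ω => ?_)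
    exact norm_inner_le_norm _ _
  refine ⟨hinner, ?_⟩
  rw [← integral_condExp hm (f := fun ω => ⟪Z ω, Y ω⟫)]
  exact integral_congr_ae (condExp_bilin_of_stronglyMeasurable_left (innerSL ℝ) hZ hinner
    (hY.integrable one_le_two)).symm

/-- One step of preconditioned stochastic gradient descent on a function with `2 * K`-Lipschitz
gradient: the expected decrease of the objective, when the preconditioner has spectrum in
`[m, M]`. -/
theorem integral_preconditioned_step_le {Ω E : Type*} {m₁ m0 : MeasurableSpace Ω} (hm₁ : m₁ ≤ m0)
    {μ : Measure Ω} [IsProbabilityMeasure μ] [NormedAddCommGroup E] [InnerProductSpace ℝ E]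
    [CompleteSpace E] {f : E → ℝ} (hf : Differentiable ℝ f)
    (hgrad : Differentiable ℝ (gradient f)) {K : ℝ}
    (hK : ∀ v, ‖fderiv ℝ (gradient f) v‖ ≤ 2 * K)
    {w w' Y : Ω → E} {B : Ω → E →L[ℝ] E} {a A m M : ℝ} (ha : 0 ≤ a) (hm : 0 < m) (hmM : m < M)
    (hw : StronglyMeasurable[m₁] w) (hB : StronglyMeasurable[m₁] B) (hY : MemLp Y 2 μ)
    (hfw : Integrable (fun ω => f (w ω)) μ) (hfw' : Integrable (fun ω => f (w' ω)) μ)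
    (hupdate : ∀ ω, w' ω = w ω - a • B ω (Y ω))
    (hmean : μ[Y | m₁] =ᵐ[μ] fun ω => gradient f (w ω))
    (hsq : ∀ᵐ ω ∂μ, (μ[fun ω' => ‖Y ω'‖ ^ 2 | m₁]) ω ≤ A)
    (hBpos : ∀ᵐ ω ∂μ, (∀ u v, ⟪B ω u, v⟫ = ⟪u, B ω v⟫) ∧
      ∀ v, m * ‖v‖ ^ 2 ≤ ⟪v, B ω v⟫ ∧ ⟪v, B ω v⟫ ≤ M * ‖v‖ ^ 2) :
    Integrable (fun ω => ‖gradient f (w ω)‖ ^ 2) μ ∧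
      ∫ ω, f (w' ω) ∂μ ≤ ∫ ω, f (w ω) ∂μ - a * (m * ∫ ω, ‖gradient f (w ω)‖ ^ 2 ∂μ)
        + K * a ^ 2 * M ^ 2 * A := by
  have hM : 0 < M := hm.trans hmM
  have hK0 : 0 ≤ K := by linarith [norm_nonneg (fderiv ℝ (gradient f) 0), hK 0]
  have hBnorm : ∀ᵐ ω ∂μ, ∀ u, ‖B ω u‖ ≤ M * ‖u‖ := by
    filter_upwards [hBpos] with ω hω u
    exact norm_apply_le_of_symmetric_of_inner_le hM hω.1
      (fun v => (by positivity : 0 ≤ m * ‖v‖ ^ 2).trans (hω.2 v).1) (fun v => (hω.2 v).2) u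
  have hg : MemLp (fun ω => gradient f (w ω)) 2 μ := (hY.condExp one_le_two).ae_eq hmean
  have hgsq : Integrable (fun ω => ‖gradient f (w ω)‖ ^ 2) μ := hg.norm.integrable_sq
  have hYsq : Integrable (fun ω => ‖Y ω‖ ^ 2) μ := hY.norm.integrable_sq
  have hZmeas : StronglyMeasurable[m₁] fun ω => B ω (gradient f (w ω)) :=
    isBoundedBilinearMap_apply.continuous.comp_stronglyMeasurable
      (hB.prodMk (hgrad.continuous.comp_stronglyMeasurable hw))
  have hZ : MemLp (fun ω => B ω (gradient f (w ω))) 2 μ :=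
    hg.of_le_mul (hZmeas.mono hm₁).aestronglyMeasurable (hBnorm.mono fun ω hω => hω _)
  obtain ⟨hinner, heq⟩ := integral_inner_condExp_right hm₁ hZmeas hZ hY
  have hlower : m * ∫ ω, ‖gradient f (w ω)‖ ^ 2 ∂μ
      ≤ ∫ ω, ⟪B ω (gradient f (w ω)), Y ω⟫ ∂μ := by
    rw [← heq, ← integral_const_mul]
    refine integral_mono_ae (hgsq.const_mul m)
      (integral_inner_condExp_right hm₁ hZmeas hZ (hY.condExp one_le_two)).1 ?_
    filter_upwards [hBpos, hmean] with ω hω hmω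
    rw [hmω, hω.1]
    exact (hω.2 _).1
  have hYA : ∫ ω, ‖Y ω‖ ^ 2 ∂μ ≤ A := by
    rw [← integral_condExp hm₁]
    simpa using integral_mono_ae integrable_condExp (integrable_const A) hsq
  refine ⟨hgsq, ?_⟩
  have hpoint : ∀ᵐ ω ∂μ, f (w' ω) ≤
      f (w ω) - a * ⟪B ω (gradient f (w ω)), Y ω⟫ + K * a ^ 2 * M ^ 2 * ‖Y ω‖ ^ 2 := by
    filter_upwards [hBpos, hBnorm] with ω hω hnω
    have h1 := le_add_inner_gradient_add_sq hf hgrad hK (w ω) (-(a • B ω (Y ω)))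
    rw [← sub_eq_add_neg, ← hupdate, inner_neg_right, real_inner_smul_right, ← hω.1, norm_neg,
      norm_smul, mul_pow, Real.norm_eq_abs, sq_abs] at h1
    have h2 : ‖B ω (Y ω)‖ ^ 2 ≤ (M * ‖Y ω‖) ^ 2 := by gcongr; exact hnω _
    have h3 : K * (a ^ 2 * ‖B ω (Y ω)‖ ^ 2) ≤ K * (a ^ 2 * (M * ‖Y ω‖) ^ 2) := by gcongr
    linarith
  calc ∫ ω, f (w' ω) ∂μ
      ≤ ∫ ω, (f (w ω) - a * ⟪B ω (gradient f (w ω)), Y ω⟫ + K * a ^ 2 * M ^ 2 * ‖Y ω‖ ^ 2) ∂μ :=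
        integral_mono_ae hfw' ((hfw.sub (hinner.const_mul a)).add (hYsq.const_mul _)) hpoint
    _ = ∫ ω, f (w ω) ∂μ - a * ∫ ω, ⟪B ω (gradient f (w ω)), Y ω⟫ ∂μ
        + K * a ^ 2 * M ^ 2 * ∫ ω, ‖Y ω‖ ^ 2 ∂μ := by
        rw [← integral_const_mul, ← integral_const_mul, ← integral_sub hfw (hinner.const_mul a)]
        exact integral_add (hfw.sub (hinner.const_mul a)) (hYsq.const_mul _)
    _ ≤ _ := by gcongr

/-- **O(1/t) rate for variable metric stochastic gradient descent**
(Theorem 3 of the paper). Under (C.1)–(C.6) with `B = 0` in (C.4), `C`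
non-negative, the ratio condition `(C (w t) - C w*) ≤ D ‖∇C (w t)‖²` a.s.,
and step sizes `a t = τ / t` with `τ > D / m`, the expected suboptimality
satisfies `limsup t (E[C (w t)] - C w*) ≤ A K M² τ² / (τ m / D - 1)`. -/
theorem variable_metric_sgd_rate
    {n : ℕ} {Ω : Type*} {m0 : MeasurableSpace Ω}
    {μ : Measure Ω} [IsProbabilityMeasure μ] (ℱ : Filtration ℕ m0)
    (C : EuclideanSpace ℝ (Fin n) → ℝ)
    (hC : ContDiff ℝ 2 C)
    (hC_nonneg : ∀ v, 0 ≤ C v)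
    (wstar : EuclideanSpace ℝ (Fin n))
    (hmin : ∀ v, C wstar ≤ C v)
    (huniq : ∀ v, (∀ u, C v ≤ C u) → v = wstar)
    (w Y : ℕ → Ω → EuclideanSpace ℝ (Fin n))
    (B : ℕ → Ω → (EuclideanSpace ℝ (Fin n) →L[ℝ] EuclideanSpace ℝ (Fin n)))
    (a : ℕ → ℝ) (ha : ∀ t, 0 < a t)
    (hw_meas : ∀ t, StronglyMeasurable[ℱ t] (w t))
    (hB_meas : ∀ t, StronglyMeasurable[ℱ t] (B t))
    (hY_meas : ∀ t, StronglyMeasurable[ℱ (t + 1)] (Y t))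
    (hY_int : ∀ t, Integrable (Y t) μ)
    (hCw_int : ∀ t, Integrable (fun ω => C (w t ω)) μ)
    (hupdate : ∀ t ω, w (t + 1) ω = w t ω - a t • (B t ω) (Y t ω))
    -- (C.1)
    (hC1 : ∀ t, μ[Y t | ℱ t] =ᵐ[μ] fun ω => gradient C (w t ω))
    -- (C.2)
    (K : ℝ) (hC2 : ∀ v, ‖fderiv ℝ (gradient C) v‖ ≤ 2 * K)
    -- (C.3)
    (hC3 : ∀ δ : ℝ, 0 < δ → ∃ c > 0, ∀ v, C v - C wstar > δ → c ≤ ‖gradient C v‖)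
    -- (C.4) with B = 0
    (A : ℝ) (hA : 0 ≤ A)
    (hYsq_int : ∀ t, Integrable (fun ω => ‖Y t ω‖ ^ 2) μ)
    (hC4 : ∀ t, ∀ᵐ ω ∂μ, (μ[fun ω' => ‖Y t ω'‖ ^ 2 | ℱ t]) ω ≤ A)
    -- (C.5)
    (m M : ℝ) (hm : 0 < m) (hmM : m < M)
    (hC5 : ∀ t, ∀ᵐ ω ∂μ,
      (∀ u v, ⟪(B t ω) u, v⟫ = ⟪u, (B t ω) v⟫) ∧
        ∀ v, m * ‖v‖ ^ 2 ≤ ⟪v, (B t ω) v⟫ ∧ ⟪v, (B t ω) v⟫ ≤ M * ‖v‖ ^ 2)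
    -- (C.6)
    (hC6a : Summable fun t => (a t) ^ 2)
    (hC6b : ¬ Summable a)
    -- ratio condition: (C (w t) - C w*) / ‖∇C (w t)‖² ≤ D
    (D : ℝ) (hD : 0 < D)
    (hratio : ∀ t, ∀ᵐ ω ∂μ,
      C (w t ω) - C wstar ≤ D * ‖gradient C (w t ω)‖ ^ 2)
    -- step sizes a t = τ / t with τ > D / m
    (τ : ℝ) (hτ : τ > D / m)
    (haτ : ∀ t : ℕ, 1 ≤ t → a t = τ / t) :
    limsup (fun t : ℕ => (t : ℝ) * ((∫ ω, C (w t ω) ∂μ) - C wstar)) atTop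
      ≤ A * K * M ^ 2 * τ ^ 2 / (τ * m / D - 1) := by
  have hK0 : 0 ≤ K := by linarith [norm_nonneg (fderiv ℝ (gradient C) 0), hC2 0]
  have hβ : 1 < τ * m / D := by
    rw [lt_div_iff₀ hD, one_mul]
    exact (div_lt_iff₀ hm).1 hτ
  have hgrad : Differentiable ℝ (gradient C) :=
    (InnerProductSpace.toDual ℝ (EuclideanSpace ℝ (Fin n))).symm.differentiable.comp
      ((hC.fderiv_right (m := 1) (by norm_num)).differentiable one_ne_zero)
  refine limsup_natCast_mul_le_of_le_one_sub_div_mul_add hβ (by positivity) (fun t => ?_)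
    (fun t ht => ?_)
  · have := integral_mono (integrable_const (C wstar)) (hCw_int t) (fun ω => hmin (w t ω))
    simp only [integral_const, probReal_univ, one_smul] at this
    linarith
  · have hYt : MemLp (Y t) 2 μ :=
      (memLp_two_iff_integrable_sq_norm (hY_int t).aestronglyMeasurable).2 (hYsq_int t)
    obtain ⟨hgsq, hstep⟩ := integral_preconditioned_step_le (ℱ.le t)
      (hC.differentiable two_ne_zero) hgrad hC2 (ha t).le hm hmM (hw_meas t) (hB_meas t) hYt
      (hCw_int t) (hCw_int (t + 1)) (hupdate t) (hC1 t) (hC4 t) (hC5 t)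
    have hsub : (∫ ω, C (w t ω) ∂μ) - C wstar
        ≤ D * ∫ ω, ‖gradient C (w t ω)‖ ^ 2 ∂μ := by
      have := integral_mono_ae ((hCw_int t).sub (integrable_const _)) (hgsq.const_mul D) (hratio t)
      rw [integral_const_mul] at this
      simpa [integral_sub (hCw_int t) (integrable_const _)] using this
    have hdesc : a t * (m / D * ((∫ ω, C (w t ω) ∂μ) - C wstar))
        ≤ a t * (m * ∫ ω, ‖gradient C (w t ω)‖ ^ 2 ∂μ) := by
      refine mul_le_mul_of_nonneg_left ?_ (ha t).le
      rw [div_mul_eq_mul_div, div_le_iff₀ hD]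
      nlinarith
    have ht' : (0 : ℝ) < t := by exact_mod_cast ht
    rw [haτ t ht] at hstep hdesc
    have h1 : τ * m / D / t * ((∫ ω, C (w t ω) ∂μ) - C wstar)
        = τ / t * (m / D * ((∫ ω, C (w t ω) ∂μ) - C wstar)) := by ring
    have h2 : A * K * M ^ 2 * τ ^ 2 / (t : ℝ) ^ 2 = K * (τ / t) ^ 2 * M ^ 2 * A := by ring
    rw [sub_mul, one_mul, h1, h2]
    linarith
end

section
/- Let (u_t)_{t≥1} be a sequence of non-negative real numbers satisfying the recursion u_t = (1 − α/t + δ_t) u_{t−1} + β/t² + ε_t for all t, where α > 1, β > 0, t·δ_t → 0 and t²·ε_t → 0 as t → ∞. Then t·u_t → β/(α − 1) as t → ∞. -/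
open Filter
open scoped Topology

/-- A non-negative sequence contracted by the factors `1 - a n`, where the partial sums of `a`
diverge to infinity, tends to zero. -/
theorem tendsto_zero_of_le_one_sub_mul_s3 {a z : ℕ → ℝ} (hz : ∀ n, 0 ≤ z n)
    (ha : Tendsto (fun n => ∑ i ∈ Finset.range n, a i) atTop atTop)
    (h : ∀ᶠ n in atTop, z (n + 1) ≤ (1 - a n) * z n) :
    Tendsto z atTop (𝓝 0) := by
  obtain ⟨N, hN⟩ := eventually_atTop.1 h
  set S : ℕ → ℝ := fun n => ∑ i ∈ Finset.range n, a i with hS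
  have key : ∀ n, N ≤ n → z n ≤ z N * Real.exp (S N) * Real.exp (-S n) := by
    intro n hn
    induction n, hn using Nat.le_induction with
    | base => rw [mul_assoc, ← Real.exp_add]; simp
    | succ n hn ih =>
      have hsucc : S (n + 1) = S n + a n := Finset.sum_range_succ a n
      calc z (n + 1) ≤ (1 - a n) * z n := hN n hn
        _ ≤ Real.exp (-a n) * z n :=
          mul_le_mul_of_nonneg_right (Real.one_sub_le_exp_neg _) (hz n)
        _ ≤ Real.exp (-a n) * (z N * Real.exp (S N) * Real.exp (-S n)) := by gcongr
        _ = z N * Real.exp (S N) * Real.exp (-S (n + 1)) := by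
          rw [hsucc, neg_add, Real.exp_add]; ring
  have hlim : Tendsto (fun n => z N * Real.exp (S N) * Real.exp (-S n)) atTop (𝓝 0) := by
    simpa using (Real.tendsto_exp_neg_atTop_nhds_zero.comp ha).const_mul (z N * Real.exp (S N))
  exact tendsto_of_tendsto_of_tendsto_of_le_of_le' tendsto_const_nhds hlim
    (Eventually.of_forall hz) (eventually_atTop.2 ⟨N, key⟩)

/-- A perturbed contraction with factors `1 - a n` and perturbations `a n * r n`, where
`∑ a n = ∞` and `r n → 0`, drives a sequence to zero. -/
theorem tendsto_zero_of_abs_le_one_sub_mul_add {a r x : ℕ → ℝ}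
    (ha0 : ∀ᶠ n in atTop, 0 ≤ a n) (ha1 : ∀ᶠ n in atTop, a n ≤ 1)
    (ha : Tendsto (fun n => ∑ i ∈ Finset.range n, a i) atTop atTop)
    (hr : Tendsto r atTop (𝓝 0))
    (h : ∀ᶠ n in atTop, |x (n + 1)| ≤ (1 - a n) * |x n| + a n * r n) :
    Tendsto x atTop (𝓝 0) := by
  rw [Metric.tendsto_nhds]
  intro η hη
  have hη2 : 0 < η / 2 := half_pos hη
  have hz : Tendsto (fun n => max (|x n| - η / 2) 0) atTop (𝓝 0) := by
    refine tendsto_zero_of_le_one_sub_mul_s3 (fun n => le_max_right _ _) ha ?_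
    filter_upwards [ha0, ha1, hr.eventually_lt_const hη2, h] with n h0 h1 hrn hn
    have hle : (1 - a n) * (|x n| - η / 2) ≤ (1 - a n) * max (|x n| - η / 2) 0 :=
      mul_le_mul_of_nonneg_left (le_max_left _ _) (sub_nonneg.2 h1)
    refine max_le ?_ (mul_nonneg (sub_nonneg.2 h1) (le_max_right _ _))
    linarith [mul_le_mul_of_nonneg_left hrn.le h0]
  filter_upwards [hz.eventually_lt_const hη2] with n hn
  rw [Real.dist_eq, sub_zero]
  linarith [le_max_left (|x n| - η / 2) 0]

/-- If `x (n + 1) = (1 - p n / (n + 1)) * x n + ρ n / (n + 1)` with `p n → γ > 0` and `ρ n → 0`,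
then `x n → 0`. -/
theorem tendsto_zero_of_eq_one_sub_div_mul_add_div {p ρ x : ℕ → ℝ} {γ : ℝ} (hγ : 0 < γ)
    (hp : Tendsto p atTop (𝓝 γ)) (hρ : Tendsto ρ atTop (𝓝 0))
    (h : ∀ n : ℕ, x (n + 1) = (1 - p n / (n + 1)) * x n + ρ n / (n + 1)) :
    Tendsto x atTop (𝓝 0) := by
  have hγ2 : 0 < γ / 2 := half_pos hγ
  have hlarge : ∀ c : ℝ, ∀ᶠ n : ℕ in atTop, c ≤ (n : ℝ) + 1 := fun c =>
    (tendsto_atTop_add_const_right _ 1 tendsto_natCast_atTop_atTop).eventually_ge_atTop c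
  refine tendsto_zero_of_abs_le_one_sub_mul_add (a := fun n : ℕ => γ / 2 * (1 / ((n : ℝ) + 1)))
    (r := fun n => |ρ n| / (γ / 2)) (Eventually.of_forall fun n => by positivity) ?_ ?_ ?_ ?_
  · filter_upwards [hlarge (γ / 2)] with n hn
    rw [mul_one_div]
    exact div_le_one_of_le₀ hn (by positivity)
  · simp_rw [← Finset.mul_sum]
    exact Real.tendsto_sum_range_one_div_nat_succ_atTop.const_mul_atTop hγ2
  · simpa using hρ.abs.div_const (γ / 2)
  · filter_upwards [hlarge (2 * γ), hp.eventually_lt_const (by linarith : γ < 2 * γ),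
      hp.eventually_const_lt (half_lt_self hγ)] with n hn hp2 hp1
    have hn0 : (0 : ℝ) < n + 1 := by positivity
    have hfac : 0 ≤ 1 - p n / (n + 1) :=
      sub_nonneg.2 (div_le_one_of_le₀ (hp2.le.trans hn) hn0.le)
    have hfac' : 1 - p n / (n + 1) ≤ 1 - γ / 2 * (1 / ((n : ℝ) + 1)) := by
      rw [mul_one_div]; gcongr
    have hrem : |ρ n / (n + 1)| = γ / 2 * (1 / ((n : ℝ) + 1)) * (|ρ n| / (γ / 2)) := by
      rw [abs_div, abs_of_pos hn0]; field_simp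
    calc |x (n + 1)| ≤ |(1 - p n / (n + 1)) * x n| + |ρ n / (n + 1)| := by
          rw [h n]; exact abs_add_le _ _
      _ = (1 - p n / (n + 1)) * |x n| + |ρ n / (n + 1)| := by rw [abs_mul, abs_of_nonneg hfac]
      _ ≤ _ := by rw [hrem]; gcongr

/-- **Bottou–LeCun sequence lemma (A.4 style).** If a sequence of non-negative
reals satisfies `u t = (1 - α/t + δ t) * u (t-1) + β/t² + ε t` for all `t ≥ 1`,
with `α > 1`, `β > 0`, `t * δ t → 0` and `t² * ε t → 0`, then
`t * u t → β / (α - 1)`. -/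
theorem bottou_lecun_sequence_lemma
    (u δ ε : ℕ → ℝ) (α β : ℝ)
    (hα : 1 < α) (hβ : 0 < β)
    (hu_nonneg : ∀ t, 0 ≤ u t)
    (hδ : Tendsto (fun t : ℕ => (t : ℝ) * δ t) atTop (𝓝 0))
    (hε : Tendsto (fun t : ℕ => (t : ℝ) ^ 2 * ε t) atTop (𝓝 0))
    (hrec : ∀ t : ℕ, 1 ≤ t →
      u t = (1 - α / t + δ t) * u (t - 1) + β / (t : ℝ) ^ 2 + ε t) :
    Tendsto (fun t : ℕ => (t : ℝ) * u t) atTop (𝓝 (β / (α - 1))) := by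
  have hα' : 0 < α - 1 := sub_pos.2 hα
  set L := β / (α - 1) with hL
  set D : ℕ → ℝ := fun n => ((n + 1 : ℕ) : ℝ) * δ (n + 1) with hD
  set E : ℕ → ℝ := fun n => ((n + 1 : ℕ) : ℝ) ^ 2 * ε (n + 1) with hE
  have hD0 : Tendsto D atTop (𝓝 0) := hδ.comp (tendsto_add_atTop_nat 1)
  have hE0 : Tendsto E atTop (𝓝 0) := hε.comp (tendsto_add_atTop_nat 1)
  have hinv : Tendsto (fun n : ℕ => 1 / ((n : ℝ) + 1)) atTop (𝓝 0) :=
    tendsto_one_div_add_atTop_nhds_zero_nat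
  set p : ℕ → ℝ := fun n => α - D n - 1 + (α - D n) * (1 / ((n : ℝ) + 1)) with hp
  have hp0 : Tendsto p atTop (𝓝 (α - 1)) := by
    have hαD : Tendsto (fun n => α - D n) atTop (𝓝 (α - 0)) := hD0.const_sub α
    simpa [hp] using (hαD.sub_const 1).add (hαD.mul hinv)
  have hρ0 : Tendsto (fun n : ℕ => (1 + 1 / ((n : ℝ) + 1)) * (β + E n) - p n * L)
      atTop (𝓝 0) := by
    have hlim := ((hinv.const_add 1).mul (hE0.const_add β)).sub (hp0.mul_const L)
    have hval : (1 + 0) * (β + 0) - (α - 1) * L = 0 := by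
      rw [hL, mul_div_cancel₀ _ hα'.ne']; ring
    rwa [hval] at hlim
  have hx : Tendsto (fun n : ℕ => ((n : ℝ) + 1) * u n - L) atTop (𝓝 0) := by
    refine tendsto_zero_of_eq_one_sub_div_mul_add_div hα' hp0 hρ0 fun n => ?_
    have hn0 : (n : ℝ) + 1 ≠ 0 := by positivity
    rw [hrec (n + 1) (Nat.le_add_left 1 n), Nat.add_sub_cancel]
    simp only [hp, hD, hE]
    push_cast
    field_simp
    ring
  have hratio := (hx.add_const L).mul (tendsto_natCast_div_add_atTop (1 : ℝ))
  rw [zero_add, mul_one] at hratio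
  refine hratio.congr fun n => ?_
  have hn0 : (n : ℝ) + 1 ≠ 0 := by positivity
  field_simp
  ring
end

section
/- Let C : ℝⁿ → ℝ be continuously differentiable with minimizer w*, satisfying: for every δ > 0, inf{‖∇C(w)‖ : C(w) − C(w*) > δ} > 0. Let (w_t) be a sequence in ℝⁿ and (a_t) positive reals with Σ_t a_t = ∞ and Σ_t a_t ‖∇C(w_t)‖² < ∞, and suppose the sequence C(w_t) converges. Then lim_{t→∞} C(w_t) = C(w*), and liminf_{t→∞} ‖∇C(w_t)‖ = 0. -/
open Filter
open scoped Topology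

/-- If `∑ a t` diverges while `∑ a t * g t ^ 2` converges, then `g` is frequently smaller than
any given positive number. -/
lemma frequently_lt_of_summable_mul_sq {a g : ℕ → ℝ} (ha : ∀ t, 0 < a t)
    (hdiv : ¬ Summable a) (hsum : Summable fun t => a t * g t ^ 2) (c : ℝ) (hc : 0 < c) :
    ∃ᶠ t in atTop, g t < c := by
  by_contra hfreq
  refine hdiv ((hsum.mul_left (c ^ 2)⁻¹).of_norm_bounded_eventually_nat ?_)
  filter_upwards [not_frequently.mp hfreq] with t ht
  have hle : c ^ 2 ≤ g t ^ 2 := pow_le_pow_left₀ hc.le (not_lt.mp ht) 2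
  rw [Real.norm_of_nonneg (ha t).le, inv_mul_eq_div, le_div_iff₀ (by positivity)]
  exact mul_le_mul_of_nonneg_left hle (ha t).le

lemma liminf_eq_zero_of_frequently_lt {g : ℕ → ℝ} (hg : ∀ t, 0 ≤ g t)
    (hfreq : ∀ c : ℝ, 0 < c → ∃ᶠ t in atTop, g t < c) : liminf g atTop = 0 := by
  have hbdd : IsBoundedUnder (· ≥ ·) atTop g := isBoundedUnder_of ⟨0, hg⟩
  have hcobdd : IsCoboundedUnder (· ≥ ·) atTop g :=
    IsCoboundedUnder.of_frequently_le ((hfreq 1 one_pos).mono fun _ ht => ht.le)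
  refine le_antisymm (le_of_forall_pos_le_add fun c hc => ?_)
    (le_liminf_of_le hcobdd (Eventually.of_forall hg))
  rw [zero_add]
  exact liminf_le_of_frequently_le ((hfreq c hc).mono fun _ ht => ht.le) hbdd

/-- **Deterministic final step of the main convergence proof.** If `C (w t)`
converges, `∑ a t ‖∇C (w t)‖² < ∞`, `∑ a t = ∞`, and the flatness condition
(C.3) holds, then `C (w t) → C w*` and `liminf ‖∇C (w t)‖ = 0`. -/
theorem deterministic_final_step {n : ℕ}
    (C : EuclideanSpace ℝ (Fin n) → ℝ)
    (hC : ContDiff ℝ 1 C)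
    (wstar : EuclideanSpace ℝ (Fin n))
    (hmin : ∀ v, C wstar ≤ C v)
    (hC3 : ∀ δ : ℝ, 0 < δ → ∃ c > 0, ∀ v, C v - C wstar > δ → c ≤ ‖gradient C v‖)
    (w : ℕ → EuclideanSpace ℝ (Fin n))
    (a : ℕ → ℝ) (ha : ∀ t, 0 < a t)
    (hdiv : ¬ Summable a)
    (hsum : Summable (fun t => a t * ‖gradient C (w t)‖ ^ 2))
    (hconv : ∃ l : ℝ, Tendsto (fun t => C (w t)) atTop (𝓝 l)) :
    Tendsto (fun t => C (w t)) atTop (𝓝 (C wstar)) ∧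
      liminf (fun t => ‖gradient C (w t)‖) atTop = 0 := by
  have hfreq := frequently_lt_of_summable_mul_sq ha hdiv hsum
  obtain ⟨l, hl⟩ := hconv
  have hl_eq : l = C wstar := by
    refine le_antisymm ?_ (ge_of_tendsto' hl fun t => hmin (w t))
    by_contra! hlt
    obtain ⟨c, hc, hcv⟩ := hC3 ((l - C wstar) / 2) (by linarith)
    have hev : ∀ᶠ t in atTop, (C wstar + l) / 2 < C (w t) :=
      hl.eventually_const_lt (by linarith)
    obtain ⟨t, hgt, ht⟩ := ((hfreq c hc).and_eventually hev).exists
    exact absurd (hcv (w t) (by linarith)) (not_le.mpr hgt)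
  exact ⟨hl_eq ▸ hl, liminf_eq_zero_of_frequently_lt (fun t => norm_nonneg _) hfreq⟩
end

section
/- Let f : ℝⁿ → ℝⁿ be continuous with a unique root w*. Let (Ω, ℱ, P) be a probability space with filtration ℱ_1 ⊆ ℱ_2 ⊆ ⋯ and let the iterates satisfy w_{t+1} = w_t − a_t Y_t, where w_t is ℱ_t-measurable, Y_t is ℱ_{t+1}-measurable, E[Y_t | ℱ_t] = f(w_t) a.s., a_t > 0, Σ_t a_t = ∞ and Σ_t a_t² < ∞. Suppose there exist finite constants A, B with E[‖Y_t‖² | ℱ_t] ≤ A + B‖w_t − w*‖² a.s. for all t, and that for every ε with 0 < ε < 1: inf{ (x − w*)ᵀ f(x) : ε < ‖x − w*‖ < ε⁻¹ } > 0. Then w_t → w* almost surely. -/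
open MeasureTheory Filter
open scoped Topology RealInnerProductSpace

/-- A supermartingale that is uniformly bounded below converges almost surely. -/
theorem MeasureTheory.Supermartingale.exists_ae_tendsto_of_bddBelow
    {Ω : Type*} {m0 : MeasurableSpace Ω} {μ : Measure Ω} [IsProbabilityMeasure μ]
    {ℱ : Filtration ℕ m0} {X : ℕ → Ω → ℝ} (hX : Supermartingale X ℱ μ)
    {K : ℝ} (hK : ∀ t ω, -K ≤ X t ω) :
    ∀ᵐ ω ∂μ, ∃ l, Tendsto (fun t => X t ω) atTop (𝓝 l) := by
  have hbdd : ∀ t, eLpNorm ((-X) t) 1 μ ≤ (∫ ω, X 0 ω ∂μ + 2 * |K|).toNNReal := by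
    intro t
    rw [eLpNorm_one_eq_lintegral_enorm, ← ofReal_integral_norm_eq_lintegral_enorm
      (hX.neg.integrable t)]
    refine ENNReal.ofReal_le_ofReal ?_
    have hint : ∫ ω, X t ω ∂μ ≤ ∫ ω, X 0 ω ∂μ := by
      simpa using hX.setIntegral_le (Nat.zero_le t) (s := Set.univ) MeasurableSet.univ
    calc ∫ ω, ‖(-X) t ω‖ ∂μ ≤ ∫ ω, (X t ω + 2 * |K|) ∂μ := by
          refine integral_mono (hX.neg.integrable t).norm
            ((hX.integrable t).add (integrable_const _)) fun ω => ?_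
          have := hK t ω
          simp only [Pi.neg_apply, norm_neg, Real.norm_eq_abs]
          exact abs_le.2 ⟨by linarith [le_abs_self K, neg_abs_le K, abs_nonneg K],
            by linarith [abs_nonneg K]⟩
      _ = ∫ ω, X t ω ∂μ + 2 * |K| := by
          rw [integral_add (hX.integrable t) (integrable_const _)]; simp
      _ ≤ _ := by gcongr
  filter_upwards [hX.neg.exists_ae_tendsto_of_bdd hbdd] with ω ⟨l, hl⟩
  exact ⟨-l, by simpa using hl.neg⟩

/-- A nonnegative process whose conditional drift is at most a summable deterministic sequence
converges almost surely. -/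
theorem ae_tendsto_of_condExp_le_add
    {Ω : Type*} {m0 : MeasurableSpace Ω} {μ : Measure Ω} [IsProbabilityMeasure μ]
    {ℱ : Filtration ℕ m0} {U : ℕ → Ω → ℝ} {c : ℕ → ℝ}
    (hU : StronglyAdapted ℱ U) (hUi : ∀ t, Integrable (U t) μ) (hU0 : ∀ t ω, 0 ≤ U t ω)
    (hc0 : ∀ t, 0 ≤ c t) (hc : Summable c)
    (hstep : ∀ t, ∀ᵐ ω ∂μ, (μ[U (t + 1) | ℱ t]) ω ≤ U t ω + c t) :
    ∀ᵐ ω ∂μ, ∃ l, Tendsto (fun t => U t ω) atTop (𝓝 l) := by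
  have hX : Supermartingale (fun t ω => U t ω - ∑ s ∈ Finset.range t, c s) ℱ μ := by
    refine supermartingale_nat (fun t => (hU t).sub stronglyMeasurable_const)
      (fun t => (hUi t).sub (integrable_const _)) fun t => ?_
    filter_upwards [hstep t, condExp_sub (hUi (t + 1))
      (integrable_const (∑ s ∈ Finset.range (t + 1), c s)) (ℱ t)] with ω h1 h2
    have h3 : (μ[fun ω => U (t + 1) ω - ∑ s ∈ Finset.range (t + 1), c s | ℱ t]) ω
        = (μ[U (t + 1) | ℱ t]) ω - ∑ s ∈ Finset.range (t + 1), c s := by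
      rw [condExp_const (ℱ.le t)] at h2
      exact h2
    rw [h3, Finset.sum_range_succ]
    linarith
  have hlow : ∀ t ω, -(∑' s, c s) ≤ U t ω - ∑ s ∈ Finset.range t, c s := fun t ω => by
    linarith [hU0 t ω, hc.sum_le_tsum (Finset.range t) fun s _ => hc0 s]
  filter_upwards [hX.exists_ae_tendsto_of_bddBelow hlow] with ω ⟨l, hl⟩
  exact ⟨l + ∑' s, c s, by simpa using hl.add hc.hasSum.tendsto_sum_nat⟩

/-- The Robbins–Siegmund theorem without multiplicative perturbation. -/
theorem ae_tendsto_and_summable_of_condExp_add_le_add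
    {Ω : Type*} {m0 : MeasurableSpace Ω} {μ : Measure Ω} [IsProbabilityMeasure μ]
    {ℱ : Filtration ℕ m0} {U H : ℕ → Ω → ℝ} {c : ℕ → ℝ}
    (hU : StronglyAdapted ℱ U) (hUi : ∀ t, Integrable (U t) μ) (hU0 : ∀ t ω, 0 ≤ U t ω)
    (hH : StronglyAdapted ℱ H) (hHi : ∀ t, Integrable (H t) μ) (hH0 : ∀ t ω, 0 ≤ H t ω)
    (hc0 : ∀ t, 0 ≤ c t) (hc : Summable c)
    (hstep : ∀ t, ∀ᵐ ω ∂μ, (μ[U (t + 1) | ℱ t]) ω + H t ω ≤ U t ω + c t) :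
    ∀ᵐ ω ∂μ, (∃ l, Tendsto (fun t => U t ω) atTop (𝓝 l)) ∧ Summable fun t => H t ω := by
  let S : ℕ → Ω → ℝ := fun t ω => ∑ s ∈ Finset.range t, H s ω
  have hSm : ∀ t, StronglyMeasurable[ℱ t] (S (t + 1)) := fun t =>
    Finset.stronglyMeasurable_fun_sum _ fun s hs =>
      (hH s).mono (ℱ.mono (Finset.mem_range_succ_iff.1 hs))
  have hSm' : ∀ t, StronglyMeasurable[ℱ t] (S t) := fun t =>
    Finset.stronglyMeasurable_fun_sum _ fun s hs =>
      (hH s).mono (ℱ.mono (Finset.mem_range.1 hs).le)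
  have hSi : ∀ t, Integrable (S t) μ := fun t => integrable_finsetSum _ fun s _ => hHi s
  have hS0 : ∀ t ω, 0 ≤ S t ω := fun t ω => Finset.sum_nonneg fun s _ => hH0 s ω
  have hlim := ae_tendsto_of_condExp_le_add hU hUi hU0 hc0 hc fun t => by
    filter_upwards [hstep t] with ω h
    linarith [hH0 t ω]
  have hlim' := ae_tendsto_of_condExp_le_add (ℱ := ℱ) (U := fun t => U t + S t)
    (fun t => (hU t).add (hSm' t)) (fun t => (hUi t).add (hSi t))
    (fun t ω => add_nonneg (hU0 t ω) (hS0 t ω)) hc0 hc fun t => by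
      filter_upwards [hstep t, condExp_add (hUi (t + 1)) (hSi (t + 1)) (ℱ t)] with ω h1 h2
      rw [h2, Pi.add_apply, condExp_of_stronglyMeasurable (ℱ.le t) (hSm t) (hSi (t + 1))]
      simp only [S, Finset.sum_range_succ, Pi.add_apply]
      linarith
  filter_upwards [hlim, hlim'] with ω ⟨l, hl⟩ ⟨l', hl'⟩
  refine ⟨⟨l, hl⟩, ?_⟩
  have hS : Tendsto (fun t => S t ω) atTop (𝓝 (l' - l)) := by
    simpa using hl'.sub hl
  exact ((hasSum_iff_tendsto_nat_of_nonneg (fun t => hH0 t ω) _).2 hS).summable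

/-- The Robbins–Siegmund almost-supermartingale convergence theorem, with deterministic
perturbations. -/
theorem robbins_siegmund_s13
    {Ω : Type*} {m0 : MeasurableSpace Ω} {μ : Measure Ω} [IsProbabilityMeasure μ]
    {ℱ : Filtration ℕ m0} {V H : ℕ → Ω → ℝ} {b c : ℕ → ℝ}
    (hV : StronglyAdapted ℱ V) (hVi : ∀ t, Integrable (V t) μ) (hV0 : ∀ t ω, 0 ≤ V t ω)
    (hH : StronglyAdapted ℱ H) (hHi : ∀ t, Integrable (H t) μ) (hH0 : ∀ t ω, 0 ≤ H t ω)
    (hb0 : ∀ t, 0 ≤ b t) (hb : Summable b) (hc0 : ∀ t, 0 ≤ c t) (hc : Summable c)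
    (hstep : ∀ t, ∀ᵐ ω ∂μ,
      (μ[V (t + 1) | ℱ t]) ω + H t ω ≤ (1 + b t) * V t ω + c t) :
    ∀ᵐ ω ∂μ, (∃ l, Tendsto (fun t => V t ω) atTop (𝓝 l)) ∧ Summable fun t => H t ω := by
  let P : ℕ → ℝ := fun t => ∏ s ∈ Finset.range t, (1 + b s)
  have hPsucc : ∀ t, P (t + 1) = P t * (1 + b t) := fun t => Finset.prod_range_succ _ _
  have hP1 : ∀ t, 1 ≤ P t := fun t => Finset.prod_induction _ (1 ≤ ·)
    (fun _ _ => one_le_mul_of_one_le_of_one_le) le_rfl fun s _ => by linarith [hb0 s]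
  have hPpos : ∀ t, 0 < P t := fun t => one_pos.trans_le (hP1 t)
  have hPC : ∀ t, P t ≤ Real.exp (∑' s, b s) := fun t =>
    (Real.prod_one_add_le_exp_sum _ hb0).trans
      (Real.exp_le_exp.2 (hb.sum_le_tsum _ fun s _ => hb0 s))
  have hPmono : Monotone P := monotone_nat_of_le_succ fun t => by
    rw [hPsucc]; nlinarith [hPpos t, hb0 t]
  obtain ⟨p, hp⟩ : ∃ p, Tendsto P atTop (𝓝 p) :=
    ⟨_, tendsto_atTop_ciSup hPmono ⟨_, Set.forall_mem_range.2 hPC⟩⟩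
  have key := ae_tendsto_and_summable_of_condExp_add_le_add (ℱ := ℱ) (μ := μ)
    (U := fun t => (P t)⁻¹ • V t) (H := fun t => (P (t + 1))⁻¹ • H t) (c := c)
    (fun t => (hV t).const_smul _) (fun t => (hVi t).smul _)
    (fun t ω => mul_nonneg (inv_nonneg.2 (hPpos t).le) (hV0 t ω))
    (fun t => (hH t).const_smul _) (fun t => (hHi t).smul _)
    (fun t ω => mul_nonneg (inv_nonneg.2 (hPpos _).le) (hH0 t ω)) hc0 hc fun t => by
      filter_upwards [hstep t, condExp_smul (μ := μ) (P (t + 1))⁻¹ (V (t + 1)) (ℱ t)] with ω h1 h2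
      rw [h2]
      simp only [Pi.smul_apply, smul_eq_mul]
      have hVP : (P (t + 1))⁻¹ * ((1 + b t) * V t ω) = (P t)⁻¹ * V t ω := by
        have h3 := (hPpos t).ne'
        have h4 : 1 + b t ≠ 0 := by linarith [hb0 t]
        rw [hPsucc]
        field_simp
      have hcP : (P (t + 1))⁻¹ * c t ≤ c t :=
        mul_le_of_le_one_left (hc0 t) (inv_le_one_of_one_le₀ (hP1 _))
      have := mul_le_mul_of_nonneg_left h1 (inv_nonneg.2 (hPpos (t + 1)).le)
      linarith
  filter_upwards [key] with ω ⟨⟨l, hl⟩, hs⟩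
  refine ⟨⟨p * l, (hp.mul hl).congr fun t => ?_⟩, ?_⟩
  · simp [mul_inv_cancel_left₀ (hPpos t).ne']
  · refine (hs.mul_left (Real.exp (∑' s, b s))).of_nonneg_of_le (fun t => hH0 t ω) fun t => ?_
    simp only [Pi.smul_apply, smul_eq_mul, ← mul_assoc]
    refine le_mul_of_one_le_left (hH0 t ω) ?_
    rw [← div_eq_mul_inv]
    exact (one_le_div (hPpos _)).2 (hPC _)

section WeightedStep

variable {Ω E : Type*} [NormedAddCommGroup E] [InnerProductSpace ℝ E]
  {m m0 : MeasurableSpace Ω} {μ : Measure Ω} {g : Ω → ℝ} {D Y : Ω → E}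

theorem integrable_weighted_inner
    (hg : AEStronglyMeasurable g μ) (hg0 : ∀ ω, 0 ≤ g ω) (hg1 : ∀ ω, g ω ≤ 1)
    (hD : AEStronglyMeasurable D μ) (hDi : Integrable (fun ω => g ω * ‖D ω‖ ^ 2) μ)
    (hY : AEStronglyMeasurable Y μ) (hYi : Integrable (fun ω => ‖Y ω‖ ^ 2) μ) :
    Integrable (fun ω => g ω * ⟪D ω, Y ω⟫) μ := by
  refine (hDi.add hYi).mono' (hg.mul (hD.inner hY)) (ae_of_all _ fun ω => ?_)
  rw [norm_mul, Real.norm_of_nonneg (hg0 ω), Pi.add_apply]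
  have h1 := norm_inner_le_norm (𝕜 := ℝ) (D ω) (Y ω)
  have h2 : ‖D ω‖ * ‖Y ω‖ ≤ ‖D ω‖ ^ 2 + ‖Y ω‖ ^ 2 := by
    nlinarith [sq_nonneg (‖D ω‖ - ‖Y ω‖), sq_nonneg (‖D ω‖), sq_nonneg (‖Y ω‖)]
  calc g ω * ‖⟪D ω, Y ω⟫‖ ≤ g ω * (‖D ω‖ ^ 2 + ‖Y ω‖ ^ 2) :=
        mul_le_mul_of_nonneg_left (h1.trans h2) (hg0 ω)
    _ ≤ g ω * ‖D ω‖ ^ 2 + ‖Y ω‖ ^ 2 := by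
        nlinarith [mul_le_of_le_one_left (sq_nonneg ‖Y ω‖) (hg1 ω)]

theorem integrable_weighted_sq {F : Type*} [NormedAddCommGroup F] {Y : Ω → F}
    (hg : AEStronglyMeasurable g μ) (hg0 : ∀ ω, 0 ≤ g ω) (hg1 : ∀ ω, g ω ≤ 1)
    (hYi : Integrable (fun ω => ‖Y ω‖ ^ 2) μ) :
    Integrable (fun ω => g ω * ‖Y ω‖ ^ 2) μ :=
  hYi.bdd_mul hg (ae_of_all _ fun ω => by rw [Real.norm_of_nonneg (hg0 ω)]; exact hg1 ω)

theorem weighted_sq_sub_smul (g : Ω → ℝ) (D Y : Ω → E) (a : ℝ) :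
    (fun ω => g ω * ‖D ω - a • Y ω‖ ^ 2) =
      (fun ω => g ω * ‖D ω‖ ^ 2) + (-(2 * a)) • (fun ω => g ω * ⟪D ω, Y ω⟫)
        + (a ^ 2) • fun ω => g ω * ‖Y ω‖ ^ 2 := by
  ext ω
  simp only [Pi.add_apply, Pi.smul_apply, smul_eq_mul]
  rw [norm_sub_sq_real, inner_smul_right, norm_smul, mul_pow, Real.norm_eq_abs, sq_abs]
  ring

theorem integrable_weighted_sq_sub_smul
    (hg : AEStronglyMeasurable g μ) (hg0 : ∀ ω, 0 ≤ g ω) (hg1 : ∀ ω, g ω ≤ 1)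
    (hD : AEStronglyMeasurable D μ) (hDi : Integrable (fun ω => g ω * ‖D ω‖ ^ 2) μ)
    (hY : AEStronglyMeasurable Y μ) (hYi : Integrable (fun ω => ‖Y ω‖ ^ 2) μ) (a : ℝ) :
    Integrable (fun ω => g ω * ‖D ω - a • Y ω‖ ^ 2) μ := by
  rw [weighted_sq_sub_smul]
  exact (hDi.add ((integrable_weighted_inner hg hg0 hg1 hD hDi hY hYi).smul _)).add
    ((integrable_weighted_sq hg hg0 hg1 hYi).smul _)

theorem condExp_weighted_inner [CompleteSpace E]
    (hm : m ≤ m0) (hg : StronglyMeasurable[m] g) (hg0 : ∀ ω, 0 ≤ g ω) (hg1 : ∀ ω, g ω ≤ 1)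
    (hD : StronglyMeasurable[m] D) (hDi : Integrable (fun ω => g ω * ‖D ω‖ ^ 2) μ)
    (hY : Integrable Y μ) (hYi : Integrable (fun ω => ‖Y ω‖ ^ 2) μ) :
    μ[fun ω => g ω * ⟪D ω, Y ω⟫ | m] =ᵐ[μ] fun ω => g ω * ⟪D ω, (μ[Y | m]) ω⟫ := by
  have hi := integrable_weighted_inner (hg.mono hm).aestronglyMeasurable hg0 hg1
    (hD.mono hm).aestronglyMeasurable hDi hY.1 hYi
  have hB : ∀ ω y, innerSL ℝ ((g • D) ω) y = g ω * ⟪D ω, y⟫ := fun ω y =>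
    real_inner_smul_left (D ω) y (g ω)
  have h := condExp_bilin_of_stronglyMeasurable_left (innerSL ℝ (E := E)) (hg.smul hD)
    (by simpa only [hB] using hi) hY
  simpa only [hB] using h

theorem condExp_weighted_sq_sub_smul [CompleteSpace E]
    (hm : m ≤ m0) [SigmaFinite (μ.trim hm)]
    (hg : StronglyMeasurable[m] g) (hg0 : ∀ ω, 0 ≤ g ω) (hg1 : ∀ ω, g ω ≤ 1)
    (hD : StronglyMeasurable[m] D) (hDi : Integrable (fun ω => g ω * ‖D ω‖ ^ 2) μ)
    (hY : Integrable Y μ) (hYi : Integrable (fun ω => ‖Y ω‖ ^ 2) μ) (a : ℝ) :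
    μ[fun ω => g ω * ‖D ω - a • Y ω‖ ^ 2 | m] =ᵐ[μ] fun ω =>
      g ω * ‖D ω‖ ^ 2 - 2 * a * (g ω * ⟪D ω, (μ[Y | m]) ω⟫)
        + a ^ 2 * (g ω * (μ[fun ω => ‖Y ω‖ ^ 2 | m]) ω) := by
  have hg' := (hg.mono hm).aestronglyMeasurable (μ := μ)
  have hZ := integrable_weighted_inner hg' hg0 hg1 (hD.mono hm).aestronglyMeasurable hDi hY.1 hYi
  have hQ := integrable_weighted_sq hg' hg0 hg1 hYi
  have hDm : StronglyMeasurable[m] fun ω => g ω * ‖D ω‖ ^ 2 := hg.mul (hD.norm.pow 2)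
  rw [weighted_sq_sub_smul]
  filter_upwards [condExp_add (hDi.add (hZ.smul (-(2 * a)))) (hQ.smul (a ^ 2)) m,
    condExp_add hDi (hZ.smul (-(2 * a))) m,
    condExp_smul (μ := μ) (-(2 * a)) (fun ω => g ω * ⟪D ω, Y ω⟫) m,
    condExp_smul (μ := μ) (a ^ 2) (fun ω => g ω * ‖Y ω‖ ^ 2) m,
    condExp_weighted_inner hm hg hg0 hg1 hD hDi hY hYi,
    condExp_mul_of_stronglyMeasurable_left hg hQ hYi] with ω h1 h2 h3 h4 h5 h6
  have h6' : (μ[fun ω => g ω * ‖Y ω‖ ^ 2 | m]) ω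
      = g ω * (μ[fun ω => ‖Y ω‖ ^ 2 | m]) ω := h6
  rw [h1, Pi.add_apply, h2, Pi.add_apply, h3, h4, condExp_of_stronglyMeasurable hm hDm hDi]
  simp only [Pi.smul_apply, smul_eq_mul, h5, h6']
  ring

end WeightedStep

/-- A sequence whose distance
to `z` converges and along which `∑ a t * ⟪x t - z, f (x t)⟫` converges must tend to `z`, when
`∑ a t` diverges and `f` points outward uniformly on annuli around `z`. -/
theorem tendsto_of_summable_mul_inner
    {E : Type*} [NormedAddCommGroup E] [InnerProductSpace ℝ E] {f : E → E} {z : E}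
    (hann : ∀ ε : ℝ, 0 < ε → ε < 1 →
      ∃ c > 0, ∀ x : E, ε < ‖x - z‖ → ‖x - z‖ < ε⁻¹ → c ≤ ⟪x - z, f x⟫)
    {a : ℕ → ℝ} (ha : ∀ t, 0 ≤ a t) (hdiv : ¬ Summable a) {x : ℕ → E} {l : ℝ}
    (hl : Tendsto (fun t => ‖x t - z‖ ^ 2) atTop (𝓝 l))
    (hs : Summable fun t => a t * ⟪x t - z, f (x t)⟫) :
    Tendsto x atTop (𝓝 z) := by
  have hr : Tendsto (fun t => ‖x t - z‖) atTop (𝓝 (Real.sqrt l)) := by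
    simpa [Real.sqrt_sq] using hl.sqrt
  rcases (Real.sqrt_nonneg l).eq_or_lt with h0 | hpos
  · rw [← h0] at hr
    exact tendsto_iff_norm_sub_tendsto_zero.2 hr
  exfalso
  set r := Real.sqrt l
  obtain ⟨ε, hε, hεlt⟩ := exists_between (lt_min hpos (lt_min one_pos (inv_pos.2 hpos)))
  obtain ⟨hεr, hε1, hε_inv⟩ : ε < r ∧ ε < 1 ∧ ε < r⁻¹ := by simpa using hεlt
  obtain ⟨c, hc, hcx⟩ := hann ε hε hε1
  refine hdiv ((summable_mul_left_iff hc.ne').1 (hs.of_norm_bounded_eventually_nat ?_))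
  filter_upwards [hr.eventually_const_lt hεr,
    hr.eventually_lt_const ((lt_inv_comm₀ hε hpos).1 hε_inv)] with t h1 h2
  rw [Real.norm_of_nonneg (mul_nonneg hc.le (ha t)), mul_comm]
  exact mul_le_mul_of_nonneg_left (hcx _ h1 h2) (ha t)

theorem inner_nonneg_of_annulus_pos
    {E : Type*} [NormedAddCommGroup E] [InnerProductSpace ℝ E] {f : E → E} {z : E}
    (hann : ∀ ε : ℝ, 0 < ε → ε < 1 →
      ∃ c > 0, ∀ x : E, ε < ‖x - z‖ → ‖x - z‖ < ε⁻¹ → c ≤ ⟪x - z, f x⟫) (x : E) :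
    0 ≤ ⟪x - z, f x⟫ := by
  rcases (norm_nonneg (x - z)).eq_or_lt with h0 | hpos
  · rw [norm_eq_zero.1 h0.symm, inner_zero_left]
  obtain ⟨ε, hε, hεlt⟩ := exists_between (lt_min hpos (lt_min one_pos (inv_pos.2 hpos)))
  obtain ⟨hεr, hε1, hε_inv⟩ : ε < ‖x - z‖ ∧ ε < 1 ∧ ε < ‖x - z‖⁻¹ := by simpa using hεlt
  obtain ⟨c, hc, hcx⟩ := hann ε hε hε1
  exact hc.le.trans (hcx x hεr ((lt_inv_comm₀ hε hpos).1 hε_inv))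

/-- **Classical multivariate Robbins–Monro convergence theorem** (Robbins–Monro,
extended by Blum). A stochastic root-finding procedure
`w (t+1) = w t - a t • Y t` with unbiased observations `E[Y t | ℱ t] = f (w t)`,
quadratically bounded second moments, diverging but square-summable step sizes,
and the annulus positivity condition converges a.s. to the unique root `w*`. -/
theorem robbins_monro
    {n : ℕ} {Ω : Type*} {m0 : MeasurableSpace Ω}
    {μ : Measure Ω} [IsProbabilityMeasure μ] (ℱ : Filtration ℕ m0)
    (f : EuclideanSpace ℝ (Fin n) → EuclideanSpace ℝ (Fin n))
    (hf : Continuous f)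
    (wstar : EuclideanSpace ℝ (Fin n))
    (hroot : f wstar = 0)
    (huniq : ∀ v, f v = 0 → v = wstar)
    (w Y : ℕ → Ω → EuclideanSpace ℝ (Fin n))
    (a : ℕ → ℝ) (ha : ∀ t, 0 < a t)
    (hw_meas : ∀ t, StronglyMeasurable[ℱ t] (w t))
    (hY_meas : ∀ t, StronglyMeasurable[ℱ (t + 1)] (Y t))
    (hY_int : ∀ t, Integrable (Y t) μ)
    (hupdate : ∀ t ω, w (t + 1) ω = w t ω - a t • Y t ω)
    (hmean : ∀ t, μ[Y t | ℱ t] =ᵐ[μ] fun ω => f (w t ω))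
    (A B : ℝ)
    (hYsq_int : ∀ t, Integrable (fun ω => ‖Y t ω‖ ^ 2) μ)
    (hsq : ∀ t, ∀ᵐ ω ∂μ,
      (μ[fun ω' => ‖Y t ω'‖ ^ 2 | ℱ t]) ω ≤ A + B * ‖w t ω - wstar‖ ^ 2)
    (hann : ∀ ε : ℝ, 0 < ε → ε < 1 →
      ∃ c > 0, ∀ x : EuclideanSpace ℝ (Fin n),
        ε < ‖x - wstar‖ → ‖x - wstar‖ < ε⁻¹ → c ≤ ⟪x - wstar, f x⟫)
    (hsumsq : Summable fun t => (a t) ^ 2)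
    (hdiv : ¬ Summable a) :
    ∀ᵐ ω ∂μ, Tendsto (fun t => w t ω) atTop (𝓝 wstar) := by
  let D : ℕ → Ω → EuclideanSpace ℝ (Fin n) := fun t ω => w t ω - wstar
  -- The weight makes the initial squared distance integrable without a moment assumption on `w 0`.
  let g : Ω → ℝ := fun ω => (1 + ‖D 0 ω‖ ^ 2)⁻¹
  have hDm : ∀ t, StronglyMeasurable[ℱ t] (D t) := fun t =>
    (hw_meas t).sub stronglyMeasurable_const
  have hden : ∀ ω, 0 < 1 + ‖D 0 ω‖ ^ 2 := fun ω => by positivity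
  have hgpos : ∀ ω, 0 < g ω := fun ω => inv_pos.2 (hden ω)
  have hg0 : ∀ ω, 0 ≤ g ω := fun ω => (hgpos ω).le
  have hg1 : ∀ ω, g ω ≤ 1 := fun ω => inv_le_one_of_one_le₀ (by simp)
  have hgm : ∀ t, StronglyMeasurable[ℱ t] g := fun t =>
    (((hDm 0).norm.measurable.pow_const 2).const_add 1).inv.stronglyMeasurable.mono
      (ℱ.mono t.zero_le)
  have hgm0 : AEStronglyMeasurable g μ := ((hgm 0).mono (ℱ.le 0)).aestronglyMeasurable
  have hDm0 : ∀ t, AEStronglyMeasurable (D t) μ := fun t =>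
    ((hDm t).mono (ℱ.le t)).aestronglyMeasurable
  have hDsucc : ∀ t, D (t + 1) = fun ω => D t ω - a t • Y t ω := fun t => by
    ext1 ω
    simp only [D, hupdate]
    abel
  have hVi : ∀ t, Integrable (fun ω => g ω * ‖D t ω‖ ^ 2) μ := by
    intro t
    induction t with
    | zero =>
      refine (integrable_const (1 : ℝ)).mono' (hgm0.mul ((hDm0 0).norm.pow 2))
        (ae_of_all _ fun ω => ?_)
      rw [Real.norm_of_nonneg (mul_nonneg (hg0 ω) (sq_nonneg _)), inv_mul_le_one₀ (hden ω)]
      linarith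
    | succ t ih =>
      rw [hDsucc]
      exact integrable_weighted_sq_sub_smul hgm0 hg0 hg1 (hDm0 t) ih (hY_int t).1 (hYsq_int t) _
  have hin : ∀ x, 0 ≤ ⟪x - wstar, f x⟫ := inner_nonneg_of_annulus_pos hann
  have hfw : ∀ t, StronglyMeasurable[ℱ t] fun ω => f (w t ω) := fun t =>
    hf.comp_stronglyMeasurable (hw_meas t)
  have hinner : ∀ t, (fun ω => g ω * ⟪D t ω, (μ[Y t | ℱ t]) ω⟫) =ᵐ[μ]
      fun ω => g ω * ⟪D t ω, f (w t ω)⟫ := fun t => by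
    filter_upwards [hmean t] with ω h
    rw [h]
  have hHi : ∀ t, Integrable (fun ω => g ω * ⟪D t ω, f (w t ω)⟫) μ := fun t =>
    integrable_condExp.congr ((condExp_weighted_inner (ℱ.le t) (hgm t) hg0 hg1 (hDm t) (hVi t)
      (hY_int t) (hYsq_int t)).trans (hinner t))
  have hRS := robbins_siegmund_s13 (ℱ := ℱ) (μ := μ)
    (V := fun t ω => g ω * ‖D t ω‖ ^ 2)
    (H := fun t ω => 2 * a t * (g ω * ⟪D t ω, f (w t ω)⟫))
    (b := fun t => |B| * a t ^ 2) (c := fun t => |A| * a t ^ 2)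
    (fun t => (hgm t).mul ((hDm t).norm.pow 2)) hVi
    (fun t ω => mul_nonneg (hg0 ω) (sq_nonneg _))
    (fun t => ((hgm t).mul ((hDm t).inner (hfw t))).const_mul _)
    (fun t => (hHi t).const_mul _)
    (fun t ω => mul_nonneg (by linarith [ha t]) (mul_nonneg (hg0 ω) (hin _)))
    (fun t => by positivity) (hsumsq.mul_left _) (fun t => by positivity) (hsumsq.mul_left _)
    fun t => by
      rw [hDsucc]
      filter_upwards [condExp_weighted_sq_sub_smul (ℱ.le t) (hgm t) hg0 hg1 (hDm t) (hVi t)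
        (hY_int t) (hYsq_int t) (a t), hinner t, hsq t] with ω h1 h2 h3
      rw [h1, h2]
      have hA : g ω * A ≤ |A| :=
        (mul_le_mul_of_nonneg_left (le_abs_self A) (hg0 ω)).trans
          (mul_le_of_le_one_left (abs_nonneg A) (hg1 ω))
      have hB : g ω * (B * ‖D t ω‖ ^ 2) ≤ |B| * (g ω * ‖D t ω‖ ^ 2) := by
        rw [mul_left_comm]
        exact mul_le_mul_of_nonneg_right (le_abs_self B) (mul_nonneg (hg0 ω) (sq_nonneg _))
      have hQ := mul_le_mul_of_nonneg_left h3 (hg0 ω)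
      have := mul_le_mul_of_nonneg_left (a := a t ^ 2)
        (show g ω * (μ[fun ω => ‖Y t ω‖ ^ 2 | ℱ t]) ω ≤ |A| + |B| * (g ω * ‖D t ω‖ ^ 2) by
          rw [mul_add] at hQ; linarith) (sq_nonneg _)
      linarith
  filter_upwards [hRS] with ω ⟨⟨l, hl⟩, hs⟩
  have hgne := (hgpos ω).ne'
  refine tendsto_of_summable_mul_inner hann (fun t => (ha t).le) hdiv (l := (g ω)⁻¹ * l) ?_ ?_
  · exact (hl.const_mul (g ω)⁻¹).congr fun t => inv_mul_cancel_left₀ hgne _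
  · refine (hs.mul_left (2 * g ω)⁻¹).congr fun t => ?_
    field_simp
    rfl
end
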